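/- arXiv:math/0503397 — 3 statements merged into one kernel-verified Lean document; each statement's English description precedes it below -/
import Mathlib

section
/- Let n ≥ 1, let 1 ≤ j ≤ n, and let φ be a continuous valuation on 𝒦(ℝⁿ). Suppose that for every convex body K and every compact set G ⊆ ℝⁿ there exists a constant C such that |φ(tK + x)| ≤ C·t^j for all t ∈ (0, 1] and all x ∈ G. Then φ(K) = 0 for every convex body K whose affine span has dimension strictly less than j. -/
open scoped Pointwise ContDiff
open MeasureTheory Set Filter

noncomputable section

/-- Euclidean space `ℝⁿ`. -/
abbrev Euc (n : ℕ) := EuclideanSpace ℝ (Fin n)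

/-- The one-point convex body `{x}`. -/
def ptBody {n : ℕ} (x : Euc n) : ConvexBody (Euc n) :=
  ⟨{x}, convex_singleton x, isCompact_singleton, Set.singleton_nonempty x⟩

/-- The convex body `t • K + x`. -/
def scaleTrans {n : ℕ} (t : ℝ) (x : Euc n) (K : ConvexBody (Euc n)) : ConvexBody (Euc n) :=
  t • K + ptBody x

/-- `φ` is a valuation: whenever `M = K ∪ L` and `N = K ∩ L` are convex bodies,
`φ M + φ N = φ K + φ L`. -/
def IsValuation {n : ℕ} (φ : ConvexBody (Euc n) → ℂ) : Prop :=
  ∀ K L M N : ConvexBody (Euc n),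
    (M : Set (Euc n)) = (K : Set (Euc n)) ∪ (L : Set (Euc n)) →
    (N : Set (Euc n)) = (K : Set (Euc n)) ∩ (L : Set (Euc n)) →
    φ M + φ N = φ K + φ L

open Classical in
/-- The value of `φ` on the set `T`, extended by `0` to sets which are not convex bodies. -/
def setVal {n : ℕ} (φ : ConvexBody (Euc n) → ℂ) (T : Set (Euc n)) : ℂ :=
  if h : Convex ℝ T ∧ IsCompact T ∧ T.Nonempty then φ ⟨T, h.1, h.2.1, h.2.2⟩ else 0

lemma setVal_coe {n : ℕ} (φ : ConvexBody (Euc n) → ℂ) (K : ConvexBody (Euc n)) :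
    setVal φ (K : Set (Euc n)) = φ K :=
  dif_pos ⟨K.convex, K.isCompact, K.nonempty⟩

lemma setVal_empty {n : ℕ} (φ : ConvexBody (Euc n) → ℂ) : setVal φ ∅ = 0 :=
  dif_neg fun h => Set.not_nonempty_empty h.2.2

/-- A valuation is additive on a decomposition into two pieces whose intersection it does not
see. -/
lemma IsValuation.setVal_union {n : ℕ} {φ : ConvexBody (Euc n) → ℂ} (hval : IsValuation φ)
    {A B : Set (Euc n)} (hA : Convex ℝ A) (hA' : IsCompact A) (hB : Convex ℝ B)
    (hB' : IsCompact B) (hAB : Convex ℝ (A ∪ B)) (h0 : setVal φ (A ∩ B) = 0) :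
    setVal φ (A ∪ B) = setVal φ A + setVal φ B := by
  rcases A.eq_empty_or_nonempty with rfl | hAn
  · simp [setVal_empty]
  rcases B.eq_empty_or_nonempty with rfl | hBn
  · simp [setVal_empty]
  have hI : (A ∩ B).Nonempty := by
    have := isPreconnected_closed_iff.1 hAB.isPreconnected A B hA'.isClosed hB'.isClosed
      subset_rfl (hAn.mono fun x hx => ⟨Or.inl hx, hx⟩) (hBn.mono fun x hx => ⟨Or.inr hx, hx⟩)
    exact this.mono inter_subset_right
  have key := hval ⟨A, hA, hA', hAn⟩ ⟨B, hB, hB', hBn⟩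
    ⟨A ∪ B, hAB, hA'.union hB', hAn.mono subset_union_left⟩
    ⟨A ∩ B, hA.inter hB, hA'.inter hB', hI⟩ rfl rfl
  simp only [← setVal_coe, ConvexBody.coe_mk] at key
  rw [← key, h0, add_zero]

lemma finrank_vectorSpan_image_lt {n m : ℕ} (f : (Fin m → ℝ) →ᵃ[ℝ] Euc n) {S : Set (Fin m → ℝ)}
    {i : Fin m} {c : ℝ} (hS : ∀ x ∈ S, x i = c) :
    Module.finrank ℝ (vectorSpan ℝ (f '' S)) < m := by
  rw [← AffineMap.map_vectorSpan]
  refine (Submodule.finrank_map_le _ _).trans_lt ?_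
  have hle : vectorSpan ℝ S ≤ LinearMap.ker (LinearMap.proj i : (Fin m → ℝ) →ₗ[ℝ] ℝ) := by
    refine Submodule.span_le.2 ?_
    rintro _ ⟨x, hx, y, hy, rfl⟩
    simp [hS x hx, hS y hy]
  have hne : vectorSpan ℝ S ≠ ⊤ := by
    intro h
    have : (Pi.single i 1 : Fin m → ℝ) ∈ vectorSpan ℝ S := h ▸ Submodule.mem_top
    simpa using hle this
  simpa using Submodule.finrank_lt hne

section Chart

variable {n m : ℕ} {φ : ConvexBody (Euc n) → ℂ} {f : (Fin m → ℝ) →ᵃ[ℝ] Euc n}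

lemma IsValuation.norm_setVal_image_le_or (hval : IsValuation φ) (hf : Function.Injective f)
    (hsimple : ∀ T : Set (Euc n), Module.finrank ℝ (vectorSpan ℝ T) < m → setVal φ T = 0)
    {S : Set (Fin m → ℝ)} (hS : Convex ℝ S) (hS' : IsCompact S) (i : Fin m) (c : ℝ) :
    ‖setVal φ (f '' S)‖ ≤ 2 * ‖setVal φ (f '' (S ∩ {x | x i ≤ c}))‖ ∨
      ‖setVal φ (f '' S)‖ ≤ 2 * ‖setVal φ (f '' (S ∩ {x | c ≤ x i}))‖ := by
  have hcont : Continuous f := f.continuous_of_finiteDimensional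
  have hlin : IsLinearMap ℝ fun x : Fin m → ℝ => x i := ⟨fun _ _ => rfl, fun _ _ => rfl⟩
  have hunion : f '' S = f '' (S ∩ {x | x i ≤ c}) ∪ f '' (S ∩ {x | c ≤ x i}) := by
    rw [← image_union, ← inter_union_distrib_left]
    congr 1
    ext x
    simpa using fun _ => le_total (x i) c
  have hadd := hval.setVal_union
    ((hS.inter (convex_halfSpace_le hlin c)).affine_image f)
    ((hS'.inter_right (isClosed_le (continuous_apply i) continuous_const)).image hcont)
    ((hS.inter (convex_halfSpace_ge hlin c)).affine_image f)
    ((hS'.inter_right (isClosed_le continuous_const (continuous_apply i))).image hcont)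
    (hunion ▸ hS.affine_image f)
    (by
      rw [← image_inter hf]
      exact hsimple _ (finrank_vectorSpan_image_lt f (i := i) (c := c)
        fun x hx => le_antisymm hx.1.2 hx.2.2))
  rw [← hunion] at hadd
  have := norm_add_le (setVal φ (f '' (S ∩ {x | x i ≤ c})))
    (setVal φ (f '' (S ∩ {x | c ≤ x i})))
  rw [← hadd] at this
  by_contra! h
  linarith [h.1, h.2]

/-- The box of points `x` with `2 ^ l i * x i ∈ [a i, a i + 1]` for all `i`. -/
def dyadicBox (l : Fin m → ℕ) (a : Fin m → ℤ) : Set (Fin m → ℝ) :=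
  {x | ∀ i, (a i : ℝ) ≤ 2 ^ l i * x i ∧ 2 ^ l i * x i ≤ a i + 1}

lemma dyadicBox_zero : dyadicBox (0 : Fin m → ℕ) 0 = Icc 0 1 := by
  ext x
  simp [dyadicBox, Pi.le_def, forall_and]

lemma dyadicBox_inter_le (l : Fin m → ℕ) (a : Fin m → ℤ) (i : Fin m) :
    dyadicBox l a ∩ {x | x i ≤ (2 * a i + 1) / 2 ^ (l i + 1)} =
      dyadicBox (Function.update l i (l i + 1)) (Function.update a i (2 * a i)) := by
  ext x
  have hpos : (0 : ℝ) < 2 ^ (l i + 1) := by positivity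
  simp only [dyadicBox, mem_inter_iff, mem_ofPred_eq, le_div_iff₀ hpos]
  constructor
  · rintro ⟨h, hi⟩ k
    rcases eq_or_ne k i with rfl | hk
    · have := h k
      simp only [Function.update_self]
      rw [pow_succ] at hi ⊢
      push_cast
      constructor <;> linarith
    · simpa [hk] using h k
  · intro h
    have hi := h i
    simp only [Function.update_self] at hi
    push_cast at hi
    refine ⟨fun k => ?_, by linarith⟩
    rcases eq_or_ne k i with rfl | hk
    · rw [pow_succ] at hi
      constructor <;> linarith
    · simpa [hk] using h k

lemma dyadicBox_inter_ge (l : Fin m → ℕ) (a : Fin m → ℤ) (i : Fin m) :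
    dyadicBox l a ∩ {x | (2 * a i + 1) / 2 ^ (l i + 1) ≤ x i} =
      dyadicBox (Function.update l i (l i + 1)) (Function.update a i (2 * a i + 1)) := by
  ext x
  have hpos : (0 : ℝ) < 2 ^ (l i + 1) := by positivity
  simp only [dyadicBox, mem_inter_iff, mem_ofPred_eq, div_le_iff₀ hpos]
  constructor
  · rintro ⟨h, hi⟩ k
    rcases eq_or_ne k i with rfl | hk
    · have := h k
      simp only [Function.update_self]
      rw [pow_succ] at hi ⊢
      push_cast
      constructor <;> linarith
    · simpa [hk] using h k
  · intro h
    have hi := h i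
    simp only [Function.update_self] at hi
    push_cast at hi
    refine ⟨fun k => ?_, by linarith⟩
    rcases eq_or_ne k i with rfl | hk
    · rw [pow_succ] at hi
      constructor <;> linarith
    · simpa [hk] using h k

lemma convex_dyadicBox (l : Fin m → ℕ) (a : Fin m → ℤ) : Convex ℝ (dyadicBox l a) := by
  intro x hx y hy s t hs ht hst i
  have hx := hx i
  have hy := hy i
  simp only [Pi.add_apply, Pi.smul_apply, smul_eq_mul]
  obtain rfl : t = 1 - s := by linarith
  constructor <;> nlinarith

lemma isClosed_dyadicBox (l : Fin m → ℕ) (a : Fin m → ℤ) : IsClosed (dyadicBox l a) := by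
  simp only [dyadicBox, ofPred_forall, ofPred_and]
  exact isClosed_iInter fun i => (isClosed_le (by fun_prop) (by fun_prop)).inter
    (isClosed_le (by fun_prop) (by fun_prop))

/-- Repeated bisection finds a dyadic box on which `φ` is at least proportionally large. -/
lemma IsValuation.exists_dyadicBox (hval : IsValuation φ) (hf : Function.Injective f)
    (hsimple : ∀ T : Set (Euc n), Module.finrank ℝ (vectorSpan ℝ T) < m → setVal φ T = 0)
    {H : Set (Fin m → ℝ)} (hH : Convex ℝ H) (hH' : IsClosed H) (s : ℕ) :
    ∀ l : Fin m → ℕ, ∑ i, l i = s → ∃ a, dyadicBox l a ⊆ Icc 0 1 ∧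
      ‖setVal φ (f '' (H ∩ Icc 0 1))‖ ≤ 2 ^ s * ‖setVal φ (f '' (H ∩ dyadicBox l a))‖ := by
  induction s with
  | zero =>
    intro l hl
    obtain rfl : l = 0 := by
      ext i
      exact Finset.sum_eq_zero_iff.1 hl i (Finset.mem_univ i)
    exact ⟨0, dyadicBox_zero.subset, by simp [dyadicBox_zero]⟩
  | succ s ih =>
    intro l hl
    obtain ⟨i, -, hi⟩ : ∃ i ∈ Finset.univ, l i ≠ 0 :=
      Finset.exists_ne_zero_of_sum_ne_zero (by omega)
    set l' := Function.update l i (l i - 1) with hl'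
    have hll : l = Function.update l' i (l' i + 1) := by
      simp [hl', Nat.sub_add_cancel (Nat.one_le_iff_ne_zero.2 hi)]
    have hsum : ∑ k, l' k = s := by
      have h1 := Finset.sum_update_of_mem (Finset.mem_univ i) l (l i - 1)
      have h2 := Finset.add_sum_erase Finset.univ l (Finset.mem_univ i)
      rw [Finset.sdiff_singleton_eq_erase, ← hl'] at h1
      omega
    obtain ⟨a, ha, hle⟩ := ih l' hsum
    have hcomp : IsCompact (H ∩ dyadicBox l' a) :=
      (isCompact_Icc.of_isClosed_subset (isClosed_dyadicBox l' a) ha).inter_left hH'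
    have hpow : (0 : ℝ) < 2 ^ s := by positivity
    rcases hval.norm_setVal_image_le_or hf hsimple (hH.inter (convex_dyadicBox l' a)) hcomp i
      ((2 * a i + 1) / 2 ^ (l' i + 1)) with h | h
    · have hsub := dyadicBox_inter_le l' a i
      rw [← hll] at hsub
      rw [inter_assoc, hsub] at h
      refine ⟨_, (hsub.symm.subset.trans inter_subset_left).trans ha, hle.trans ?_⟩
      rw [pow_succ, mul_assoc]
      exact mul_le_mul_of_nonneg_left h hpow.le
    · have hsub := dyadicBox_inter_ge l' a i
      rw [← hll] at hsub
      rw [inter_assoc, hsub] at h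
      refine ⟨_, (hsub.symm.subset.trans inter_subset_left).trans ha, hle.trans ?_⟩
      rw [pow_succ, mul_assoc]
      exact mul_le_mul_of_nonneg_left h hpow.le

/-- The polyhedron `{x | ∀ k, ⟨u k, x⟩ ≤ b k}` with integral data. -/
def latticePoly {ι : Type*} (u : ι → Fin m → ℤ) (b : ι → ℤ) : Set (Fin m → ℝ) :=
  {x | ∀ k, ∑ i, (u k i : ℝ) * x i ≤ b k}

lemma convex_latticePoly {ι : Type*} (u : ι → Fin m → ℤ) (b : ι → ℤ) :
    Convex ℝ (latticePoly u b) := by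
  rw [latticePoly, ofPred_forall]
  refine convex_iInter fun k => convex_halfSpace_le ⟨fun x y => ?_, fun c x => ?_⟩ _
  · simp [mul_add, Finset.sum_add_distrib]
  · simp [Finset.mul_sum, mul_left_comm]

lemma isClosed_latticePoly {ι : Type*} (u : ι → Fin m → ℤ) (b : ι → ℤ) :
    IsClosed (latticePoly u b) := by
  rw [latticePoly, ofPred_forall]
  exact isClosed_iInter fun k => isClosed_le (by fun_prop) continuous_const

lemma abs_sum_mul_le (v : Fin m → ℤ) {y : Fin m → ℝ} (hy : y ∈ Icc (0 : Fin m → ℝ) 1) :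
    |∑ i, (v i : ℝ) * y i| ≤ (∑ i, |v i| : ℤ) := by
  push_cast
  refine (Finset.abs_sum_le_sum_abs _ _).trans (Finset.sum_le_sum fun i _ => ?_)
  rw [abs_mul, abs_of_nonneg (hy.1 i)]
  exact mul_le_of_le_one_right (abs_nonneg _) (hy.2 i)

/-- Only finitely many sets arise by intersecting the unit cube with integral polyhedra with
prescribed normals. -/
lemma finite_range_latticePoly_inter {ι : Type*} [Finite ι] (u : ι → Fin m → ℤ) :
    (range fun d : ι → ℤ => latticePoly u d ∩ Icc 0 1).Finite := by
  set M : ι → ℤ := fun k => ∑ i, |u k i| with hM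
  have hfin : (Set.univ.pi fun k => Icc (-M k - 1) (M k)).Finite :=
    Set.Finite.pi fun k => Set.finite_Icc _ _
  refine (hfin.image fun d : ι → ℤ => latticePoly u d ∩ Icc 0 1).subset ?_
  rintro _ ⟨d, rfl⟩
  have hM0 : ∀ k, 0 ≤ M k := fun k => Finset.sum_nonneg fun i _ => abs_nonneg _
  refine ⟨fun k => max (-M k - 1) (min (d k) (M k)), fun k _ => ⟨le_max_left _ _,
    max_le (by linarith [hM0 k]) (min_le_right _ _)⟩, ?_⟩
  ext y
  simp only [mem_inter_iff, latticePoly, mem_ofPred_eq, and_congr_left_iff]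
  refine fun hy => forall_congr' fun k => ?_
  have hb := abs_le.1 (abs_sum_mul_le (u k) hy)
  push_cast [hM] at hb ⊢
  rw [le_max_iff, le_min_iff]
  constructor
  · rintro (h | h)
    · linarith [hb.1]
    · exact h.1
  · exact fun h => Or.inr ⟨h, hb.2⟩

/-- A dyadic piece of an integral polyhedron is a scaled translate of a piece of the unit cube. -/
lemma latticePoly_inter_dyadicBox {ι : Type*} (u : ι → Fin m → ℤ) (b : ι → ℤ) (q : ℕ)
    (a : Fin m → ℤ) :
    latticePoly u b ∩ dyadicBox (fun _ => q) a =
      (fun y => ((2 : ℝ) ^ q)⁻¹ • y + ((2 : ℝ) ^ q)⁻¹ • fun i => (a i : ℝ)) ''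
        (latticePoly u (fun k => 2 ^ q * b k - ∑ i, u k i * a i) ∩ Icc 0 1) := by
  have hq : (0 : ℝ) < 2 ^ q := by positivity
  have hmem : ∀ y : Fin m → ℝ,
      ((2 : ℝ) ^ q)⁻¹ • y + ((2 : ℝ) ^ q)⁻¹ • (fun i => (a i : ℝ)) ∈
        latticePoly u b ∩ dyadicBox (fun _ => q) a ↔
      y ∈ latticePoly u (fun k => 2 ^ q * b k - ∑ i, u k i * a i) ∩ Icc 0 1 := by
    intro y
    refine and_congr (forall_congr' fun k => ?_) ?_
    · have : ∑ i, (u k i : ℝ) * (((2 : ℝ) ^ q)⁻¹ • y +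
          ((2 : ℝ) ^ q)⁻¹ • (fun i => (a i : ℝ))) i =
          (∑ i, (u k i : ℝ) * y i + ∑ i, (u k i : ℝ) * a i) / 2 ^ q := by
        rw [← Finset.sum_add_distrib, Finset.sum_div]
        refine Finset.sum_congr rfl fun i _ => ?_
        simp only [Pi.add_apply, Pi.smul_apply, smul_eq_mul]
        field_simp
      rw [this, div_le_iff₀ hq]
      push_cast
      constructor <;> intro h <;> linarith
    · simp only [dyadicBox, mem_ofPred_eq, mem_Icc, Pi.le_def, ← forall_and]
      refine forall_congr' fun i => ?_
      have : (2 : ℝ) ^ q * (((2 : ℝ) ^ q)⁻¹ • y +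
          ((2 : ℝ) ^ q)⁻¹ • (fun i => (a i : ℝ))) i = y i + a i := by
        simp only [Pi.add_apply, Pi.smul_apply, smul_eq_mul]
        field_simp
      rw [this]
      simp only [Pi.zero_apply, Pi.one_apply]
      constructor <;> rintro ⟨h1, h2⟩ <;> constructor <;> linarith
  ext x
  constructor
  · intro hx
    have hx' : ((2 : ℝ) ^ q)⁻¹ • ((2 : ℝ) ^ q • x - fun i => (a i : ℝ)) +
        ((2 : ℝ) ^ q)⁻¹ • (fun i => (a i : ℝ)) = x := by
      rw [smul_sub, inv_smul_smul₀ hq.ne', sub_add_cancel]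
    exact ⟨_, (hmem _).1 (hx'.symm ▸ hx), hx'⟩
  · rintro ⟨y, hy, rfl⟩
    exact (hmem y).2 hy

lemma exists_bound_setVal {j : ℕ}
    (hbound : ∀ (K : ConvexBody (Euc n)) (G : Set (Euc n)), IsCompact G →
      ∃ C : ℝ, ∀ t : ℝ, t ∈ Set.Ioc (0 : ℝ) 1 → ∀ x ∈ G, ‖φ (scaleTrans t x K)‖ ≤ C * t ^ j)
    {T : Set (Euc n)} (hT : Convex ℝ T) (hT' : IsCompact T) {G : Set (Euc n)}
    (hG : IsCompact G) :
    ∃ C : ℝ, ∀ t ∈ Ioc (0 : ℝ) 1, ∀ x ∈ G,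
      ‖setVal φ ((fun y => t • y + x) '' T)‖ ≤ C * t ^ j := by
  rcases T.eq_empty_or_nonempty with rfl | hne
  · exact ⟨0, by simp [setVal_empty]⟩
  obtain ⟨C, hC⟩ := hbound ⟨T, hT, hT', hne⟩ G hG
  refine ⟨C, fun t ht x hx => ?_⟩
  convert hC t ht x hx
  rw [← setVal_coe φ]
  congr 1
  simp only [scaleTrans, ptBody, ConvexBody.coe_add, ConvexBody.coe_smul, ConvexBody.coe_mk,
    add_singleton, ← image_smul, image_image]

lemma IsValuation.setVal_image_latticePoly_eq_zero {j : ℕ} (hval : IsValuation φ)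
    (hbound : ∀ (K : ConvexBody (Euc n)) (G : Set (Euc n)), IsCompact G →
      ∃ C : ℝ, ∀ t : ℝ, t ∈ Set.Ioc (0 : ℝ) 1 → ∀ x ∈ G, ‖φ (scaleTrans t x K)‖ ≤ C * t ^ j)
    (hmj : m < j) (hf : Function.Injective f)
    (hsimple : ∀ T : Set (Euc n), Module.finrank ℝ (vectorSpan ℝ T) < m → setVal φ T = 0)
    {ι : Type*} [Finite ι] (u : ι → Fin m → ℤ) (b : ι → ℤ) :
    setVal φ (f '' (latticePoly u b ∩ Icc 0 1)) = 0 := by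
  have hcont : Continuous f := f.continuous_of_finiteDimensional
  have hG : IsCompact (f '' Icc 0 1) := isCompact_Icc.image hcont
  have hex : ∃ C : ℝ, ∀ P ∈ range fun d : ι → ℤ => latticePoly u d ∩ Icc 0 1,
      ∀ t ∈ Ioc (0 : ℝ) 1, ∀ x ∈ f '' Icc 0 1,
        ‖setVal φ ((fun y => t • y + x) '' (f.linear '' P))‖ ≤ C * t ^ j := by
    have hpiece : ∀ P ∈ range fun d : ι → ℤ => latticePoly u d ∩ Icc 0 1, ∃ C : ℝ,
        ∀ t ∈ Ioc (0 : ℝ) 1, ∀ x ∈ f '' Icc 0 1,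
          ‖setVal φ ((fun y => t • y + x) '' (f.linear '' P))‖ ≤ C * t ^ j := by
      rintro _ ⟨d, rfl⟩
      exact exists_bound_setVal hbound
        (((convex_latticePoly u d).inter (convex_Icc 0 1)).linear_image f.linear)
        ((isCompact_Icc.inter_left (isClosed_latticePoly u d)).image
          f.linear.continuous_of_finiteDimensional) hG
    choose! C hC using hpiece
    obtain ⟨B, hB⟩ := ((finite_range_latticePoly_inter u).image C).bddAbove
    refine ⟨B, fun P hP t ht x hx => (hC P hP t ht x hx).trans ?_⟩
    exact mul_le_mul_of_nonneg_right (hB (mem_image_of_mem C hP)) (pow_nonneg ht.1.le j)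
  obtain ⟨C, hC⟩ := hex
  have hmain : ∀ q : ℕ,
      ‖setVal φ (f '' (latticePoly u b ∩ Icc 0 1))‖ ≤ |C| * (1 / 2) ^ q := by
    intro q
    obtain ⟨a, ha, hle⟩ := hval.exists_dyadicBox hf hsimple (convex_latticePoly u b)
      (isClosed_latticePoly u b) (m * q) (fun _ => q) (by simp)
    set t : ℝ := ((2 : ℝ) ^ q)⁻¹ with ht
    have hq : (1 : ℝ) ≤ 2 ^ q := one_le_pow₀ one_le_two
    have ht0 : 0 < t := by positivity
    have ht1 : t ≤ 1 := inv_le_one_of_one_le₀ hq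
    have hcorner : (t • fun i => (a i : ℝ)) ∈ dyadicBox (fun _ => q) a := by
      intro i
      simp [ht]
    have hpiece := hC _ ⟨fun k => 2 ^ q * b k - ∑ i, u k i * a i, rfl⟩ t ⟨ht0, ht1⟩ _
      (mem_image_of_mem f (ha hcorner))
    have himage : f '' (latticePoly u b ∩ dyadicBox (fun _ => q) a) =
        (fun y => t • y + f (t • fun i => (a i : ℝ))) '' (f.linear ''
          (latticePoly u (fun k => 2 ^ q * b k - ∑ i, u k i * a i) ∩ Icc 0 1)) := by
      rw [latticePoly_inter_dyadicBox, image_image, image_image]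
      refine image_congr fun y _ => ?_
      have := f.map_vadd (t • fun i => (a i : ℝ)) (t • y)
      simpa only [vadd_eq_add, map_smul] using this
    rw [← himage] at hpiece
    calc ‖setVal φ (f '' (latticePoly u b ∩ Icc 0 1))‖
        ≤ 2 ^ (m * q) * (|C| * t ^ (m + 1)) := by
          refine hle.trans (mul_le_mul_of_nonneg_left (hpiece.trans ?_) (by positivity))
          exact mul_le_mul (le_abs_self C) (pow_le_pow_of_le_one ht0.le ht1 hmj)
            (by positivity) (abs_nonneg C)
      _ = |C| * (1 / 2) ^ q := by
          rw [ht, pow_mul', pow_succ, inv_pow, one_div, inv_pow]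
          field_simp
  have hlim : Tendsto (fun q : ℕ => |C| * (1 / 2 : ℝ) ^ q) atTop (nhds 0) := by
    simpa using (tendsto_pow_atTop_nhds_zero_of_lt_one (r := (1 / 2 : ℝ)) (by norm_num)
      (by norm_num)).const_mul |C|
  exact norm_le_zero_iff.1 (ge_of_tendsto' hlim hmain)

lemma exists_integral_separation {S : Set (Fin m → ℝ)} (hS : Convex ℝ S) (hS' : IsClosed S)
    (hbox : S ⊆ Icc 0 1) {x : Fin m → ℝ} (hx : x ∈ Icc (0 : Fin m → ℝ) 1) (hxS : x ∉ S) :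
    ∃ p : (Fin m → ℤ) × ℤ, (∀ y ∈ S, ∑ i, (p.1 i : ℝ) * y i ≤ p.2) ∧
      (p.2 : ℝ) < ∑ i, (p.1 i : ℝ) * x i := by
  obtain ⟨g, c, hgS, hgx⟩ := geometric_hahn_banach_closed_point hS hS' hxS
  have hg : ∀ y : Fin m → ℝ, g y = ∑ i, g (Pi.single i 1) * y i := by
    intro y
    conv_lhs => rw [pi_eq_sum_univ' y, map_sum]
    refine Finset.sum_congr rfl fun i _ => ?_
    rw [map_smul, smul_eq_mul, mul_comm]
  obtain ⟨N, hN⟩ := exists_nat_gt ((m + 1) / (g x - c))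
  rw [div_lt_iff₀ (sub_pos.2 hgx)] at hN
  refine ⟨⟨fun i => ⌊N * g (Pi.single i 1)⌋, ⌈N * c⌉⟩, fun y hy => ?_, ?_⟩
  · calc ∑ i, (⌊N * g (Pi.single i 1)⌋ : ℝ) * y i
        ≤ ∑ i, N * g (Pi.single i 1) * y i := Finset.sum_le_sum fun i _ =>
          mul_le_mul_of_nonneg_right (Int.floor_le _) ((hbox hy).1 i)
      _ = N * g y := by simp only [hg y, Finset.mul_sum, mul_assoc]
      _ ≤ N * c := mul_le_mul_of_nonneg_left (hgS y hy).le (Nat.cast_nonneg N)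
      _ ≤ ⌈N * c⌉ := Int.le_ceil _
  · calc (⌈N * c⌉ : ℝ) < N * c + 1 := Int.ceil_lt_add_one _
      _ ≤ N * g x - m := by linarith
      _ = ∑ i, (N * g (Pi.single i 1) * x i - 1) := by
          simp [hg x, Finset.mul_sum, mul_assoc]
      _ ≤ ∑ i, (⌊N * g (Pi.single i 1)⌋ : ℝ) * x i := by
          refine Finset.sum_le_sum fun i _ => ?_
          have h1 := Int.lt_floor_add_one (N * g (Pi.single i 1))
          have h2 := hx.1 i
          have h3 := hx.2 i
          simp only [Pi.zero_apply, Pi.one_apply] at h2 h3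
          nlinarith

/-- Convex bodies in the unit cube are approximated from outside by integral polyhedra. -/
lemma exists_latticePoly_between {S U : Set (Fin m → ℝ)} (hS : Convex ℝ S) (hS' : IsClosed S)
    (hbox : S ⊆ Icc 0 1) (hU : IsOpen U) (hSU : S ⊆ U) :
    ∃ t : Finset ((Fin m → ℤ) × ℤ),
      S ⊆ latticePoly (fun p : t => p.1.1) (fun p => p.1.2) ∧
      latticePoly (fun p : t => p.1.1) (fun p => p.1.2) ∩ Icc 0 1 ⊆ U := by
  classical
  let I := {p : (Fin m → ℤ) × ℤ // ∀ y ∈ S, ∑ i, (p.1 i : ℝ) * y i ≤ p.2}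
  have hcomp : IsCompact (Icc (0 : Fin m → ℝ) 1 \ U) := isCompact_Icc.diff hU
  obtain ⟨t, ht⟩ := hcomp.elim_finite_subcover
    (fun p : I => {x : Fin m → ℝ | (p.1.2 : ℝ) < ∑ i, (p.1.1 i : ℝ) * x i})
    (fun p => isOpen_lt continuous_const (by fun_prop))
    (fun x hx => by
      obtain ⟨p, hp, hpx⟩ :=
        exists_integral_separation hS hS' hbox hx.1 fun h => hx.2 (hSU h)
      exact mem_iUnion.2 ⟨⟨p, hp⟩, hpx⟩)
  refine ⟨t.image Subtype.val, fun y hy p => ?_, fun x hx => ?_⟩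
  · obtain ⟨p', -, hp'⟩ := Finset.mem_image.1 p.2
    have := p'.2 y hy
    rwa [hp'] at this
  · by_contra hxU
    obtain ⟨p, hpt, hpx⟩ := mem_iUnion₂.1 (ht ⟨hx.2, hxU⟩)
    exact absurd hpx (not_lt.2 (hx.1 ⟨p.1, Finset.mem_image_of_mem _ hpt⟩))

end Chart

/-- A convex body is contained in a parallelepiped of the same dimension. -/
lemma exists_injective_subset_image_Icc {n m : ℕ} (K : ConvexBody (Euc n))
    (hm : Module.finrank ℝ (vectorSpan ℝ (K : Set (Euc n))) = m) :
    ∃ f : (Fin m → ℝ) →ᵃ[ℝ] Euc n, Function.Injective f ∧ (K : Set (Euc n)) ⊆ f '' Icc 0 1 := by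
  obtain ⟨x₀, hx₀⟩ := K.nonempty
  let e : (Fin m → ℝ) ≃ₗ[ℝ] vectorSpan ℝ (K : Set (Euc n)) :=
    LinearEquiv.ofFinrankEq _ _ (by simp [hm])
  let L : (Fin m → ℝ) →ₗ[ℝ] Euc n := (vectorSpan ℝ (K : Set (Euc n))).subtype ∘ₗ e.toLinearMap
  have hL : Function.Injective L := Subtype.val_injective.comp e.injective
  have hemb : Topology.IsClosedEmbedding L :=
    LinearMap.isClosedEmbedding_of_injective (LinearMap.ker_eq_bot.2 hL)
  have hcomp : IsCompact (L ⁻¹' ((fun y => y - x₀) '' (K : Set (Euc n)))) :=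
    hemb.isCompact_preimage (K.isCompact.image (by fun_prop))
  obtain ⟨R, hR, hRb⟩ := hcomp.isBounded.exists_pos_norm_le
  refine ⟨((2 * R) • L).toAffineMap + AffineMap.const ℝ _ (x₀ - L fun _ => R), ?_, ?_⟩
  · intro x y hxy
    have : (2 * R) • L x = (2 * R) • L y := by simpa using hxy
    exact hL (smul_right_injective _ (by positivity : (2 * R) ≠ 0) this)
  · intro y hy
    obtain ⟨w, hw⟩ := e.surjective ⟨y - x₀, vsub_mem_vectorSpan ℝ hy hx₀⟩
    have hLw : L w = y - x₀ := congrArg Subtype.val hw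
    have hwR := hRb w ⟨y, hy, hLw.symm⟩
    refine ⟨fun i => (w i + R) / (2 * R), ⟨fun i => ?_, fun i => ?_⟩, ?_⟩
    · have := abs_le.1 ((norm_le_pi_norm w i).trans hwR)
      exact div_nonneg (by linarith) (by positivity)
    · have := abs_le.1 ((norm_le_pi_norm w i).trans hwR)
      exact (div_le_one (by positivity)).2 (by linarith)
    · have hfun : (2 * R) • (fun i => (w i + R) / (2 * R)) = w + fun _ => R := by
        ext i
        simp only [Pi.smul_apply, smul_eq_mul, Pi.add_apply]
        field_simp
      simp only [AffineMap.coe_add, Pi.add_apply, LinearMap.coe_toAffineMap,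
        LinearMap.smul_apply, AffineMap.const_apply]
      rw [← map_smul, hfun, map_add, hLw]
      abel

/-- If a continuous valuation `φ` satisfies a bound `|φ(tK + x)| ≤ C t^j` (uniformly for `x` in
compact sets), then `φ` vanishes on all convex bodies whose affine span has dimension `< j`. -/
theorem vanishes_on_lower_dimensional_bodies {n : ℕ} (hn : 1 ≤ n)
    (j : ℕ) (hj1 : 1 ≤ j) (hjn : j ≤ n)
    (φ : ConvexBody (Euc n) → ℂ) (hval : IsValuation φ) (hcont : Continuous φ)
    (hbound : ∀ (K : ConvexBody (Euc n)) (G : Set (Euc n)), IsCompact G →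
      ∃ C : ℝ, ∀ t : ℝ, t ∈ Set.Ioc (0 : ℝ) 1 → ∀ x ∈ G,
        ‖φ (scaleTrans t x K)‖ ≤ C * t ^ j) :
    ∀ K : ConvexBody (Euc n),
      Module.finrank ℝ ↥(vectorSpan ℝ (K : Set (Euc n))) < j → φ K = 0 := by
  suffices h : ∀ m < j, ∀ K : ConvexBody (Euc n),
      Module.finrank ℝ (vectorSpan ℝ (K : Set (Euc n))) = m → φ K = 0 from
    fun K hK => h _ hK K rfl
  intro m
  induction m using Nat.strong_induction_on with
  | _ m ih =>
    intro hmj K hK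
    have hsimple : ∀ T : Set (Euc n), Module.finrank ℝ (vectorSpan ℝ T) < m →
        setVal φ T = 0 := by
      intro T hT
      rw [setVal]
      split_ifs with h
      · exact ih _ hT (hT.trans hmj) ⟨T, h.1, h.2.1, h.2.2⟩ rfl
      · rfl
    obtain ⟨f, hf, hKf⟩ := exists_injective_subset_image_Icc K hK
    have hfc : Continuous f := f.continuous_of_finiteDimensional
    have hSbox : f ⁻¹' K ⊆ Icc 0 1 := by
      intro x hx
      obtain ⟨y, hy, hyx⟩ := hKf hx
      exact hf hyx ▸ hy
    have hKS : (K : Set (Euc n)) ⊆ f '' (f ⁻¹' K) := by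
      intro y hy
      obtain ⟨x, -, rfl⟩ := hKf hy
      exact ⟨x, hy, rfl⟩
    have hdense : K ∈ closure (φ ⁻¹' {0}) := by
      refine Metric.mem_closure_iff.2 fun ε hε => ?_
      obtain ⟨t, hSt, htU⟩ := exists_latticePoly_between (K.convex.affine_preimage f)
        (K.isClosed.preimage hfc) hSbox
        ((Metric.isOpen_thickening (δ := ε / 2) (E := (K : Set (Euc n)))).preimage hfc)
        (preimage_mono (Metric.self_subset_thickening (half_pos hε) _))
      set P := latticePoly (fun p : t => p.1.1) (fun p => p.1.2) ∩ Icc 0 1 with hP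
      have hKP : (K : Set (Euc n)) ⊆ f '' P :=
        hKS.trans (image_mono (subset_inter hSt hSbox))
      let Q : ConvexBody (Euc n) := ⟨f '' P,
        ((convex_latticePoly _ _).inter (convex_Icc 0 1)).affine_image f,
        (isCompact_Icc.inter_left (isClosed_latticePoly _ _)).image hfc, K.nonempty.mono hKP⟩
      refine ⟨Q, ?_, lt_of_le_of_lt ?_ (half_lt_self hε)⟩
      · rw [mem_preimage, mem_singleton_iff, ← setVal_coe φ]
        exact hval.setVal_image_latticePoly_eq_zero hbound hmj hf hsimple _ _
      · rw [← ConvexBody.hausdorffDist_coe]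
        refine Metric.hausdorffDist_le_of_mem_dist (half_pos hε).le
          (fun x hx => ⟨x, hKP hx, by simpa using (half_pos hε).le⟩) ?_
        rintro _ ⟨x, hx, rfl⟩
        obtain ⟨z, hz, hd⟩ := Metric.mem_thickening_iff.1 (htU hx)
        exact ⟨z, hz, hd.le⟩
    exact (isClosed_singleton.preimage hcont).closure_subset hdense
end
end

section
/- Let n ≥ 1, let s ≥ 1, let f : ℝⁿ → ℂ be C^∞, let K, A', A'', A_2, …, A_s be convex bodies in ℝⁿ, and let a, b ≥ 0. Then ∂^s/∂λ_1⋯∂λ_s |_{λ=0} ∫_{K + λ_1(aA' + bA'') + λ_2 A_2 + ⋯ + λ_s A_s} f = a · ∂^s/∂λ_1⋯∂λ_s |_{λ=0} ∫_{K + λ_1 A' + λ_2 A_2 + ⋯ + λ_s A_s} f + b · ∂^s/∂λ_1⋯∂λ_s |_{λ=0} ∫_{K + λ_1 A'' + λ_2 A_2 + ⋯ + λ_s A_s} f, where aA' + bA'' denotes the Minkowski combination {a·x + b·y : x ∈ A', y ∈ A''} and all mixed partial derivatives at λ = 0 are one-sided (they exist since the integrals are smooth functions of λ ∈ ℝ_{≥0}^s).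 -/
open scoped Pointwise ContDiff
open MeasureTheory Set Filter

noncomputable section

/-- One-sided partial derivative in the `i`-th coordinate: the derivative of
`t ↦ g(λ with i-th coordinate replaced by t)` within `[0, ∞)` (so one-sided at `0`). -/
def pderivOrth {s : ℕ} {F : Type*} [NormedAddCommGroup F] [NormedSpace ℝ F]
    (g : (Fin s → ℝ) → F) (i : Fin s) : (Fin s → ℝ) → F :=
  fun lam => derivWithin (fun t => g (Function.update lam i t)) (Set.Ici 0) (lam i)

/-- The iterated one-sided mixed partial derivative `∂^s/∂λ₁⋯∂λ_s |_{λ=0}` of a function on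
the closed orthant `ℝ_{≥0}^s`. -/
def mixedPartialAtZero {s : ℕ} {F : Type*} [NormedAddCommGroup F] [NormedSpace ℝ F]
    (g : (Fin s → ℝ) → F) : F :=
  (List.foldl pderivOrth g (List.finRange s)) 0

section GradientMap

variable {E : Type*} [NormedAddCommGroup E] [InnerProductSpace ℝ E]

open scoped Gradient RealInnerProductSpace Topology

/-- The first-order characterisation of convexity. -/
lemma ConvexOn.add_inner_gradient_le [CompleteSpace E] {φ : E → ℝ} (hc : ConvexOn ℝ univ φ) {x : E}
    (hd : DifferentiableAt ℝ φ x) (y : E) : φ x + ⟪∇ φ x, y - x⟫ ≤ φ y := by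
  have hline : ConvexOn ℝ univ (fun t : ℝ => φ (x + t • (y - x))) := by
    have : ConvexOn ℝ univ (φ ∘ (AffineMap.lineMap x y : ℝ →ᵃ[ℝ] E)) := hc.comp_affineMap _
    convert this using 2 with t
    simp [AffineMap.lineMap_apply, add_comm]
  have hder : HasDerivAt (fun t : ℝ => φ (x + t • (y - x))) ⟪∇ φ x, y - x⟫ 0 := by
    have h1 : HasDerivAt (fun t : ℝ => x + t • (y - x)) (y - x) 0 := by
      simpa using ((hasDerivAt_id (0 : ℝ)).smul_const (y - x)).const_add x
    have h2 : HasFDerivAt φ (fderiv ℝ φ x) (x + (0 : ℝ) • (y - x)) := by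
      simpa using hd.hasFDerivAt
    rw [inner_gradient_left]
    exact h2.comp_hasDerivAt 0 h1
  have := hline.le_slope_of_hasDerivAt (mem_univ 0) (mem_univ 1) one_pos hder
  simp only [slope_def_field, one_smul, zero_smul, add_zero, sub_zero, div_one,
    add_sub_cancel] at this
  linarith

/-- A smooth convex function `φ` that plays the role of a smoothed support function of `S`. -/
structure IsGradientPotential (S : Set E) (φ : E → ℝ) : Prop where
  isCompact : IsCompact S
  nonempty : S.Nonempty
  convex : Convex ℝ S
  contDiff : ContDiff ℝ ∞ φ
  convexOn : ConvexOn ℝ univ φ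
  exists_le_add_inner : ∀ x v, ∃ p ∈ S, φ (x + v) ≤ φ x + ⟪v, p⟫
  exists_inner_le_add : ∃ C, ∀ x, ∀ q ∈ S, ⟪x, q⟫ ≤ φ x + C

namespace IsGradientPotential

variable {S T : Set E} {φ ψ : E → ℝ}

lemma zero : IsGradientPotential (0 : Set E) 0 where
  isCompact := isCompact_singleton
  nonempty := singleton_nonempty 0
  convex := convex_singleton 0
  contDiff := contDiff_const
  convexOn := convexOn_const 0 convex_univ
  exists_le_add_inner x v := ⟨0, rfl, by simp⟩
  exists_inner_le_add := ⟨0, by rintro x q rfl; simp⟩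

lemma add (hS : IsGradientPotential S φ) (hT : IsGradientPotential T ψ) :
    IsGradientPotential (S + T) (φ + ψ) where
  isCompact := hS.isCompact.add hT.isCompact
  nonempty := hS.nonempty.add hT.nonempty
  convex := hS.convex.add hT.convex
  contDiff := hS.contDiff.add hT.contDiff
  convexOn := hS.convexOn.add hT.convexOn
  exists_le_add_inner x v := by
    obtain ⟨p, hp, h⟩ := hS.exists_le_add_inner x v
    obtain ⟨q, hq, h'⟩ := hT.exists_le_add_inner x v
    refine ⟨p + q, add_mem_add hp hq, ?_⟩
    simp only [Pi.add_apply, inner_add_right]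
    linarith
  exists_inner_le_add := by
    obtain ⟨C, hC⟩ := hS.exists_inner_le_add
    obtain ⟨D, hD⟩ := hT.exists_inner_le_add
    refine ⟨C + D, ?_⟩
    rintro x _ ⟨p, hp, q, hq, rfl⟩
    have := hC x p hp
    have := hD x q hq
    simp only [Pi.add_apply, inner_add_right]
    linarith

lemma smul (hS : IsGradientPotential S φ) {c : ℝ} (hc : 0 ≤ c) :
    IsGradientPotential (c • S) (c • φ) where
  isCompact := hS.isCompact.smul c
  nonempty := hS.nonempty.smul_set
  convex := hS.convex.smul c
  contDiff := contDiff_const.smul hS.contDiff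
  convexOn := hS.convexOn.smul hc
  exists_le_add_inner x v := by
    obtain ⟨p, hp, h⟩ := hS.exists_le_add_inner x v
    refine ⟨c • p, smul_mem_smul_set hp, ?_⟩
    simp only [Pi.smul_apply, smul_eq_mul, inner_smul_right]
    nlinarith
  exists_inner_le_add := by
    obtain ⟨C, hC⟩ := hS.exists_inner_le_add
    refine ⟨c * C, ?_⟩
    rintro x _ ⟨p, hp, rfl⟩
    have := hC x p hp
    simp only [Pi.smul_apply, smul_eq_mul, inner_smul_right]
    nlinarith

lemma sum {ι : Type*} (s : Finset ι) {S : ι → Set E} {φ : ι → E → ℝ}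
    (h : ∀ i, IsGradientPotential (S i) (φ i)) :
    IsGradientPotential (∑ i ∈ s, S i) (∑ i ∈ s, φ i) := by
  classical
  induction s using Finset.induction_on with
  | empty => simpa using zero
  | insert i s hi ih =>
    rw [Finset.sum_insert hi, Finset.sum_insert hi]
    exact (h i).add ih

variable (h : IsGradientPotential S φ)
include h

lemma differentiable : Differentiable ℝ φ := h.contDiff.differentiable (by simp)

variable [FiniteDimensional ℝ E]

lemma contDiff_gradient : ContDiff ℝ ∞ (∇ φ) :=
  (InnerProductSpace.toDual ℝ E).symm.contDiff.comp (h.contDiff.fderiv_right (by simp))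

lemma add_inner_gradient_le (x y : E) : φ x + ⟪∇ φ x, y - x⟫ ≤ φ y :=
  h.convexOn.add_inner_gradient_le (h.differentiable x) y

lemma gradient_mem (x : E) : ∇ φ x ∈ S := by
  by_contra hx
  obtain ⟨l, u, hl, hu⟩ := geometric_hahn_banach_closed_point h.convex h.isCompact.isClosed hx
  set v := (InnerProductSpace.toDual ℝ E).symm l
  have hv (y : E) : l y = ⟪v, y⟫ := by simp [v]
  obtain ⟨p, hp, hle⟩ := h.exists_le_add_inner x v
  have h1 := h.add_inner_gradient_le x (x + v)
  have h2 := hl p hp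
  rw [hv] at h2 hu
  rw [add_sub_cancel_left, real_inner_comm] at h1
  linarith

lemma gradient_eq_of_forall_le {x y : E} (hx : ∀ w, φ x + ⟪y, w - x⟫ ≤ φ w) : ∇ φ x = y := by
  have hmin : IsLocalMin (fun w => φ w - ⟪y, w⟫) x := by
    refine Filter.Eventually.of_forall fun w => ?_
    have := hx w
    rw [inner_sub_right] at this
    simp only
    linarith
  have h1 : HasFDerivAt (fun w => φ w - ⟪y, w⟫) (fderiv ℝ φ x - innerSL ℝ y) x :=
    (h.differentiable x).hasFDerivAt.sub (innerSL ℝ y).hasFDerivAt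
  have h2 := hmin.hasFDerivAt_eq_zero h1
  refine ext_inner_right ℝ fun v => ?_
  rw [inner_gradient_left, sub_eq_zero.mp h2, innerSL_apply_apply]

lemma interior_subset_range_gradient : interior S ⊆ range (∇ φ) := by
  intro y hy
  obtain ⟨r, hr, hball⟩ := Metric.mem_nhds_iff.mp (mem_interior_iff_mem_nhds.mp hy)
  obtain ⟨C, hC⟩ := h.exists_inner_le_add
  have hlow (x : E) : r / 2 * ‖x‖ - C ≤ φ x - ⟪y, x⟫ := by
    have hmem : y + (r / 2 * ‖x‖⁻¹) • x ∈ S := by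
      apply hball
      rw [Metric.mem_ball, dist_eq_norm, add_sub_cancel_left, norm_smul, norm_mul, norm_inv,
        norm_norm, Real.norm_of_nonneg (by positivity), mul_assoc]
      have : ‖x‖⁻¹ * ‖x‖ ≤ 1 := inv_mul_le_one
      nlinarith
    have h1 := hC x _ hmem
    rw [inner_add_right, inner_smul_right, real_inner_self_eq_norm_sq, real_inner_comm] at h1
    have h2 : r / 2 * ‖x‖⁻¹ * ‖x‖ ^ 2 = r / 2 * ‖x‖ := by
      rcases eq_or_ne ‖x‖ 0 with h0 | h0
      · simp [h0]
      · field_simp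
    linarith
  have hcont : Continuous (fun x => φ x - ⟪y, x⟫) :=
    h.contDiff.continuous.sub (innerSL ℝ y).continuous
  have htend : Tendsto (fun x => φ x - ⟪y, x⟫) (cocompact E) atTop := by
    refine tendsto_atTop_mono hlow ?_
    exact tendsto_atTop_add_const_right _ _
      ((tendsto_norm_cocompact_atTop (E := E)).const_mul_atTop (by positivity))
  obtain ⟨x, hx⟩ := hcont.exists_forall_le htend
  refine ⟨x, h.gradient_eq_of_forall_le fun w => ?_⟩
  have := hx w
  rw [inner_sub_right]
  linarith

lemma hasFDerivAt_gradient (x : E) : HasFDerivAt (∇ φ) (fderiv ℝ (∇ φ) x) x :=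
  (h.contDiff_gradient.differentiable (by simp) x).hasFDerivAt

lemma isPositive_fderiv_gradient (x : E) :
    (fderiv ℝ (∇ φ) x : E →ₗ[ℝ] E).IsPositive := by
  have hd := h.hasFDerivAt_gradient x
  refine ⟨fun v w => ?_, fun v => ?_⟩
  · have h1 : HasFDerivAt (fderiv ℝ φ)
        ((InnerProductSpace.toDual ℝ E).toContinuousLinearEquiv.toContinuousLinearMap.comp
          (fderiv ℝ (∇ φ) x)) x := by
      rw [← toDual_comp_gradient]
      exact (InnerProductSpace.toDual ℝ E).toContinuousLinearEquiv.hasFDerivAt.comp x hd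
    have h2 := second_derivative_symmetric (fun y => (h.differentiable y).hasFDerivAt) h1 v w
    simp at h2
    simp only [ContinuousLinearMap.coe_coe]
    rw [h2, real_inner_comm]
  · have hmono : Monotone (fun t : ℝ => ⟪∇ φ (x + t • v), v⟫) := by
      intro s t hst
      rcases hst.eq_or_lt with rfl | hlt
      · rfl
      have h1 := h.add_inner_gradient_le (x + s • v) (x + t • v)
      have h2 := h.add_inner_gradient_le (x + t • v) (x + s • v)
      rw [show x + t • v - (x + s • v) = (t - s) • v by module, inner_smul_right] at h1
      rw [show x + s • v - (x + t • v) = (s - t) • v by module, inner_smul_right] at h2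
      simp only
      nlinarith
    have hder : HasDerivAt (fun t : ℝ => ⟪∇ φ (x + t • v), v⟫) ⟪fderiv ℝ (∇ φ) x v, v⟫ 0 := by
      have h1 : HasDerivAt (fun t : ℝ => x + t • v) v 0 := by
        simpa using ((hasDerivAt_id (0 : ℝ)).smul_const v).const_add x
      have h2 : HasFDerivAt (∇ φ) (fderiv ℝ (∇ φ) x) (x + (0 : ℝ) • v) := by simpa using hd
      simpa using (h2.comp_hasDerivAt 0 h1).inner ℝ (hasDerivAt_const (0 : ℝ) v)
    have := hder.deriv ▸ hmono.deriv_nonneg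
    simpa using this

lemma det_fderiv_gradient_nonneg (x : E) : 0 ≤ (fderiv ℝ (∇ φ) x).det := by
  have := (LinearMap.posSemidef_toMatrix_iff (stdOrthonormalBasis ℝ E)).mpr
    (h.isPositive_fderiv_gradient x)
  simpa [LinearMap.det_toMatrix] using this.det_nonneg

lemma det_fderiv_eq_zero_of_gradient_eq {x x' : E} (hne : x ≠ x') (heq : ∇ φ x = ∇ φ x') :
    (fderiv ℝ (∇ φ) x).det = 0 := by
  have hseg (t : ℝ) (ht : t ∈ Icc (0 : ℝ) 1) : ∇ φ (x + t • (x' - x)) = ∇ φ x := by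
    refine h.gradient_eq_of_forall_le fun w => ?_
    have h1 := h.add_inner_gradient_le x w
    have h2 := h.add_inner_gradient_le x' x
    have h3 : φ (x + t • (x' - x)) ≤ (1 - t) * φ x + t * φ x' := by
      have := h.convexOn.2 (mem_univ x) (mem_univ x') (sub_nonneg.mpr ht.2) ht.1 (by ring)
      rwa [show (1 - t) • x + t • x' = x + t • (x' - x) by module] at this
    rw [← heq, ← neg_sub x' x, inner_neg_right] at h2
    rw [← sub_sub, inner_sub_right _ _ (t • _), inner_smul_right]
    nlinarith [ht.1]
  have hv : fderiv ℝ (∇ φ) x (x' - x) = 0 := by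
    have h1 : HasDerivAt (fun t : ℝ => x + t • (x' - x)) (x' - x) 0 := by
      simpa using ((hasDerivAt_id (0 : ℝ)).smul_const (x' - x)).const_add x
    have h2 : HasFDerivAt (∇ φ) (fderiv ℝ (∇ φ) x) (x + (0 : ℝ) • (x' - x)) := by
      simpa using h.hasFDerivAt_gradient x
    have h3 := (h2.comp_hasDerivAt 0 h1).hasDerivWithinAt (s := Icc 0 1)
    have h4 : HasDerivWithinAt (∇ φ ∘ fun t : ℝ => x + t • (x' - x)) 0 (Icc 0 1) 0 :=
      (hasDerivWithinAt_const (0 : ℝ) (Icc 0 1) (∇ φ x)).congr (fun t ht => hseg t ht)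
        (hseg 0 (by simp))
    exact (uniqueDiffOn_Icc_zero_one 0 (by simp)).eq_deriv _ h3 h4
  by_contra hdet
  have := LinearMap.ker_eq_bot.mp ((LinearMap.isUnit_iff_ker_eq_bot _).mp
    (LinearMap.isUnit_iff_isUnit_det _ |>.mpr (isUnit_iff_ne_zero.mpr hdet)))
  exact hne (sub_eq_zero.mp (this (by simpa using hv))).symm

lemma continuous_det : Continuous fun x => (fderiv ℝ (∇ φ) x).det :=
  ContinuousLinearMap.continuous_det.comp (h.contDiff_gradient.continuous_fderiv (by simp))

lemma injOn_gradient : InjOn (∇ φ) {x | (fderiv ℝ (∇ φ) x).det ≠ 0} := by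
  intro x hx x' _ heq
  by_contra hne
  exact hx (h.det_fderiv_eq_zero_of_gradient_eq hne heq)

variable [MeasurableSpace E] [BorelSpace E]

lemma image_gradient_ae_eq (μ : Measure E) [μ.IsAddHaarMeasure] :
    ∇ φ '' {x | (fderiv ℝ (∇ φ) x).det ≠ 0} =ᵐ[μ] S := by
  have hnull : μ (∇ φ '' {x | (fderiv ℝ (∇ φ) x).det = 0}) = 0 :=
    addHaar_image_eq_zero_of_det_fderivWithin_eq_zero μ
      (fun x _ => (h.hasFDerivAt_gradient x).hasFDerivWithinAt) (fun x hx => hx)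
  have hfr := h.convex.addHaar_frontier μ
  refine (ae_le_set.mpr ?_).antisymm (ae_le_set.mpr ?_)
  · rw [sdiff_eq_empty.mpr]
    · simp
    · rintro _ ⟨x, -, rfl⟩
      exact h.gradient_mem x
  · refine measure_mono_null (t := frontier S ∪ ∇ φ '' {x | (fderiv ℝ (∇ φ) x).det = 0}) ?_
      (measure_union_null hfr hnull)
    rintro y ⟨hy, hy'⟩
    by_cases hi : y ∈ interior S
    · obtain ⟨x, rfl⟩ := h.interior_subset_range_gradient hi
      refine Or.inr ⟨x, ?_, rfl⟩
      by_contra hx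
      exact hy' ⟨x, hx, rfl⟩
    · exact Or.inl ⟨subset_closure hy, hi⟩

lemma measurableSet_det_ne_zero : MeasurableSet {x | (fderiv ℝ (∇ φ) x).det ≠ 0} :=
  (h.continuous_det.measurable (measurableSet_singleton (0 : ℝ))).compl

lemma integrable_det (μ : Measure E) [μ.IsAddHaarMeasure] :
    Integrable (fun x => (fderiv ℝ (∇ φ) x).det) μ := by
  have h1 : IntegrableOn (fun _ => (1 : ℝ)) (∇ φ '' {x | (fderiv ℝ (∇ φ) x).det ≠ 0}) μ :=
    (integrableOn_const (h.isCompact.measure_lt_top.ne) (by simp)).congr_set_ae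
      (h.image_gradient_ae_eq μ)
  rw [integrableOn_image_iff_integrableOn_abs_det_fderiv_smul μ h.measurableSet_det_ne_zero
    (fun x _ => (h.hasFDerivAt_gradient x).hasFDerivWithinAt) h.injOn_gradient] at h1
  simp only [smul_eq_mul, mul_one, abs_of_nonneg (h.det_fderiv_gradient_nonneg _)] at h1
  rw [← integrableOn_univ]
  refine h1.of_forall_sdiff_eq_zero MeasurableSet.univ fun x hx => ?_
  simpa using hx.2

/-- Change of variables along the gradient map. -/
lemma setIntegral_eq {F : Type*} [NormedAddCommGroup F] [NormedSpace ℝ F] (μ : Measure E)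
    [μ.IsAddHaarMeasure] (f : E → F) :
    ∫ y in S, f y ∂μ = ∫ x, (fderiv ℝ (∇ φ) x).det • f (∇ φ x) ∂μ := by
  rw [← setIntegral_congr_set (h.image_gradient_ae_eq μ),
    integral_image_eq_integral_abs_det_fderiv_smul μ h.measurableSet_det_ne_zero
    (fun x _ => (h.hasFDerivAt_gradient x).hasFDerivWithinAt) h.injOn_gradient]
  simp only [abs_of_nonneg (h.det_fderiv_gradient_nonneg _)]
  refine setIntegral_eq_integral_of_forall_compl_eq_zero fun x hx => ?_
  rw [mem_ofPred_eq, not_not] at hx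
  rw [hx, zero_smul]

end IsGradientPotential

end GradientMap

section Existence

open scoped RealInnerProductSpace Convolution

variable {E : Type*} [NormedAddCommGroup E] [InnerProductSpace ℝ E] [FiniteDimensional ℝ E]
  [MeasurableSpace E] [BorelSpace E]

/-- Every convex body has a gradient potential: mollify its support function. -/
lemma exists_isGradientPotential {S : Set E} (hS : IsCompact S) (hne : S.Nonempty)
    (hconv : Convex ℝ S) : ∃ φ, IsGradientPotential S φ := by
  have hmax (v : E) : ∃ p ∈ S, ∀ q ∈ S, ⟪v, q⟫ ≤ ⟪v, p⟫ :=
    hS.exists_isMaxOn hne (innerSL ℝ v).continuous.continuousOn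
  choose p hpS hp using hmax
  set H : E → ℝ := fun v => ⟪v, p v⟫
  obtain ⟨R, hR0, hR⟩ := hS.isBounded.exists_pos_norm_le
  have hHadd (x v : E) : H (x + v) ≤ H x + ⟪v, p v⟫ := by
    simp only [H, inner_add_left]
    exact add_le_add (hp x _ (hpS _)) (hp v _ (hpS _))
  have hH0 (v : E) : ⟪v, p v⟫ ≤ R * ‖v‖ := by
    rw [mul_comm]
    exact (real_inner_le_norm _ _).trans (by gcongr; exact hR _ (hpS v))
  have hHcont : Continuous H := by
    refine (LipschitzWith.of_le_add_mul R.toNNReal fun x y => ?_).continuous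
    rw [Real.coe_toNNReal _ hR0.le, dist_eq_norm]
    calc H x = H (y + (x - y)) := by rw [add_sub_cancel]
      _ ≤ _ := (hHadd y (x - y)).trans (by gcongr; exact hH0 _)
  have hHconvex : ConvexOn ℝ univ H := by
    refine ⟨convex_univ, fun x _ y _ a b ha hb _ => ?_⟩
    simp only [H, inner_add_left, inner_smul_left, smul_eq_mul, RCLike.conj_to_real]
    exact add_le_add (mul_le_mul_of_nonneg_left (hp x _ (hpS _)) ha)
      (mul_le_mul_of_nonneg_left (hp y _ (hpS _)) hb)
  let bump : ContDiffBump (0 : E) := ⟨1, 2, one_pos, one_lt_two⟩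
  set ρ : E → ℝ := bump.normed volume
  have hρ0 (z : E) : 0 ≤ ρ z := bump.nonneg_normed z
  have hρc : HasCompactSupport ρ := bump.hasCompactSupport_normed
  have hρcont : Continuous ρ := bump.continuous_normed
  have hρ1 : ∫ z, ρ z = 1 := bump.integral_normed
  have hint (g : E → ℝ) (hg : Continuous g) : Integrable (fun z => ρ z * g z) :=
    (hρcont.mul hg).integrable_of_hasCompactSupport hρc.mul_right
  have hshift (x : E) : Continuous (fun z => H (x - z)) := by fun_prop
  have hconst (c : ℝ) : ∫ z, ρ z * c = c := by rw [integral_mul_const, hρ1, one_mul]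
  refine ⟨fun x => ∫ z, ρ z * H (x - z), hS, hne, hconv, ?_, ⟨convex_univ, ?_⟩, ?_, ?_⟩
  · exact hρc.contDiff_convolution_left (ContinuousLinearMap.lsmul ℝ ℝ) bump.contDiff_normed
      hHcont.locallyIntegrable (n := ⊤)
  · intro x _ y _ a b ha hb hab
    simp only [smul_eq_mul]
    rw [← integral_const_mul, ← integral_const_mul, ← integral_add
      ((hint _ (hshift x)).const_mul a) ((hint _ (hshift y)).const_mul b)]
    refine integral_mono (hint _ (hshift _))
      (((hint _ (hshift x)).const_mul a).add ((hint _ (hshift y)).const_mul b)) fun z => ?_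
    have h1 := hHconvex.2 (mem_univ (x - z)) (mem_univ (y - z)) ha hb hab
    rw [show a • (x - z) + b • (y - z) = a • x + b • y - z by
      rw [smul_sub, smul_sub, sub_add_sub_comm, ← add_smul, hab, one_smul], smul_eq_mul,
      smul_eq_mul] at h1
    have h2 := mul_le_mul_of_nonneg_left h1 (hρ0 z)
    simp only
    linarith
  · intro x v
    refine ⟨p v, hpS v, ?_⟩
    rw [← hconst ⟪v, p v⟫, ← integral_add (hint _ (hshift x)) (hint _ continuous_const)]
    refine integral_mono (hint _ (hshift _))
      ((hint _ (hshift x)).add (hint _ continuous_const)) fun z => ?_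
    have h1 := mul_le_mul_of_nonneg_left (hHadd (x - z) v) (hρ0 z)
    rw [sub_add_eq_add_sub, mul_add] at h1
    exact h1
  · refine ⟨∫ z, ρ z * (R * ‖z‖), fun x q hq => ?_⟩
    rw [← hconst ⟪x, q⟫,
      ← integral_add (hint _ (hshift x)) (hint _ (by fun_prop))]
    refine integral_mono (hint _ continuous_const)
      ((hint _ (hshift x)).add (hint _ (by fun_prop))) fun z => ?_
    have h1 : ⟪x, q⟫ ≤ H (x - z) + R * ‖z‖ := by
      rw [← sub_add_cancel x z, inner_add_left, sub_add_cancel]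
      exact add_le_add (hp _ q hq) ((hp z q hq).trans (hH0 z))
    have h2 := mul_le_mul_of_nonneg_left h1 (hρ0 z)
    rw [mul_add] at h2
    exact h2

end Existence

section Interpolation

open Polynomial

/-- A function on `ℝ^ι` that is polynomial of degree `< d` in each variable separately is a
combination, with smooth coefficients, of its values at finitely many points of the orthant. -/
lemma exists_interpolation (ι : Type) [Fintype ι] [DecidableEq ι] (d : ℕ) :
    ∃ (κ : Type) (_ : Fintype κ) (N : κ → ι → ℝ) (L : κ → (ι → ℝ) → ℝ),
      (∀ k i, 0 ≤ N k i) ∧ (∀ k, ContDiff ℝ ∞ (L k)) ∧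
      ∀ P : (ι → ℝ) → ℝ,
        (∀ l i, ∃ p : ℝ[X], p.degree < d ∧ ∀ t, P (Function.update l i t) = p.eval t) →
        ∀ l, P l = ∑ k, L k l * P (N k) := by
  suffices H : ∀ s : Finset ι,
      ∃ (κ : Type) (_ : Fintype κ) (N : κ → ι → ℝ) (L : κ → (ι → ℝ) → ℝ),
      (∀ k i, 0 ≤ N k i) ∧ (∀ k, ContDiff ℝ ∞ (L k)) ∧
      ∀ P : (ι → ℝ) → ℝ,
        (∀ l i, ∃ p : ℝ[X], p.degree < d ∧ ∀ t, P (Function.update l i t) = p.eval t) →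
        ∀ l, P l = ∑ k, L k l * P (s.piecewise (N k) l) by
    simpa using H Finset.univ
  intro s
  induction s using Finset.induction_on with
  | empty =>
    exact ⟨Unit, inferInstance, fun _ _ => 0, fun _ _ => 1, fun _ _ => le_rfl,
      fun _ => contDiff_const, fun P _ l => by simp⟩
  | insert a s ha ih =>
    obtain ⟨κ, _, N, L, hN, hL, hP⟩ := ih
    refine ⟨κ × Fin d, inferInstance, fun k => Function.update (N k.1) a (k.2 : ℕ),
      fun k l => L k.1 l *
        (Lagrange.basis Finset.univ (fun j : Fin d => ((j : ℕ) : ℝ)) k.2).eval (l a),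
      ?_, ?_, ?_⟩
    · intro k i
      rcases eq_or_ne i a with rfl | hi
      · simp
      · simpa [hi] using hN k.1 i
    · intro k
      refine (hL k.1).mul ?_
      have h := Polynomial.contDiff_aeval (𝕜 := ℝ) (Lagrange.basis Finset.univ
        (fun j : Fin d => ((j : ℕ) : ℝ)) k.2) ∞
      simp only [coe_aeval_eq_eval] at h
      exact h.comp (contDiff_apply ℝ ℝ a)
    · intro P hpoly l
      rw [hP P hpoly l, Fintype.sum_prod_type]
      refine Finset.sum_congr rfl fun k _ => ?_
      obtain ⟨p, hdeg, hp⟩ := hpoly (s.piecewise (N k) l) a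
      have hinj : Set.InjOn (fun j : Fin d => ((j : ℕ) : ℝ)) (Finset.univ : Finset (Fin d)) :=
        fun i _ j _ hij => Fin.ext (Nat.cast_injective hij)
      have hl : P (s.piecewise (N k) l) = p.eval (l a) := by
        rw [← hp]
        congr 1
        rw [eq_comm, Function.update_eq_self_iff]
        simp [ha]
      rw [hl, Lagrange.eq_interpolate (f := p) hinj (by simpa using hdeg), Lagrange.interpolate_apply,
        eval_finsetSum, Finset.mul_sum]
      refine Finset.sum_congr rfl fun j _ => ?_
      simp only [eval_mul, eval_C, ← hp, Finset.piecewise_insert, Function.update_self]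
      have : s.piecewise (Function.update (N k) a ((j : ℕ) : ℝ)) l = s.piecewise (N k) l := by
        refine s.piecewise_congr (fun i hi => ?_) (fun _ _ => rfl)
        rw [Function.update_of_ne]
        rintro rfl
        exact ha hi
      simp only [this]
      ring

/-- The determinant of an affine pencil of endomorphisms is polynomial of degree at most the
dimension. -/
lemma exists_polynomial_det_add_smul {E : Type*} [NormedAddCommGroup E] [NormedSpace ℝ E]
    [FiniteDimensional ℝ E] (B A : E →L[ℝ] E) :
    ∃ p : ℝ[X], p.degree < (Module.finrank ℝ E + 1 : ℕ) ∧
      ∀ t : ℝ, (B + t • A).det = p.eval t := by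
  let b := Module.finBasis ℝ E
  let M (T : E →L[ℝ] E) := LinearMap.toMatrix b b (T : E →ₗ[ℝ] E)
  refine ⟨((X : ℝ[X]) • (M A).map C + (M B).map C).det, ?_, fun t => ?_⟩
  · have := natDegree_det_X_add_C_le (M A) (M B)
    rw [Fintype.card_fin] at this
    exact degree_le_natDegree.trans_lt (by exact_mod_cast Nat.lt_succ_of_le this)
  · rw [ContinuousLinearMap.det, ← LinearMap.det_toMatrix b, eval_det]
    congr 1
    ext i j
    simp [M, add_comm, mul_comm]

lemma sum_update_smul {ι M : Type*} [Fintype ι] [DecidableEq ι] [AddCommGroup M] [Module ℝ M]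
    (A : ι → M) (l : ι → ℝ) (i : ι) (t : ℝ) :
    ∑ j, Function.update l i t j • A j = ∑ j, Function.update l i 0 j • A j + t • A i := by
  have hupd : Function.update l i t = Function.update l i 0 + Pi.single i t := by
    ext j
    rcases eq_or_ne j i with rfl | hj <;> simp [*]
  simp [hupd, add_smul, Finset.sum_add_distrib, Pi.single_apply, ite_smul]

lemma exists_polynomial_det_add_sum {E ι : Type*} [NormedAddCommGroup E] [NormedSpace ℝ E]
    [FiniteDimensional ℝ E] [Fintype ι] [DecidableEq ι] (B : E →L[ℝ] E) (A : ι → E →L[ℝ] E)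
    (l : ι → ℝ) (i : ι) :
    ∃ p : ℝ[X], p.degree < (Module.finrank ℝ E + 1 : ℕ) ∧
      ∀ t : ℝ, (B + ∑ j, Function.update l i t j • A j).det = p.eval t := by
  obtain ⟨p, hdeg, hp⟩ :=
    exists_polynomial_det_add_smul (B + ∑ j, Function.update l i 0 j • A j) (A i)
  exact ⟨p, hdeg, fun t => by rw [sum_update_smul A l i t, ← add_assoc, hp]⟩

end Interpolation

section ParametricIntegral

open scoped Topology

set_option maxSynthPendingDepth 4 in
/-- Smooth dependence of `∫ B x (f (w x + T x l)) dμ(x)` on `l`, where the coefficient `B` is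
integrable and `w`, `T` are bounded. -/
lemma contDiff_integral_comp_affine {X E Λ : Type} [TopologicalSpace X] [MeasurableSpace X]
    [OpensMeasurableSpace X] [SecondCountableTopology X] {μ : Measure X}
    [NormedAddCommGroup E] [NormedSpace ℝ E] [FiniteDimensional ℝ E]
    [NormedAddCommGroup Λ] [NormedSpace ℝ Λ]
    {w : X → E} {T : X → Λ →L[ℝ] E} (hw : Continuous w) (hT : Continuous T)
    {C : ℝ} (hwC : ∀ x, ‖w x‖ ≤ C) (hTC : ∀ x, ‖T x‖ ≤ C) (k : ℕ) :
    ∀ {F G : Type} [NormedAddCommGroup F] [NormedSpace ℝ F] [NormedAddCommGroup G]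
      [NormedSpace ℝ G] {f : E → F} {B : X → F →L[ℝ] G}, ContDiff ℝ ∞ f → Continuous B →
      Integrable B μ → ContDiff ℝ k (fun l => ∫ x, B x (f (w x + T x l)) ∂μ) := by
  have hbound {F : Type} [NormedAddCommGroup F] {g : E → F} (hg : Continuous g) (r : ℝ) :
      ∃ D, ∀ l : Λ, ‖l‖ ≤ r → ∀ x, ‖g (w x + T x l)‖ ≤ D := by
    obtain ⟨D, hD⟩ := (isCompact_closedBall (0 : E) (C + C * r)).exists_bound_of_continuousOn
      hg.continuousOn
    refine ⟨D, fun l hl x => hD _ ?_⟩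
    rw [mem_closedBall_zero_iff]
    have hC : 0 ≤ C := (norm_nonneg _).trans (hwC x)
    refine (norm_add_le _ _).trans (add_le_add (hwC x) (((T x).le_opNorm l).trans ?_))
    gcongr
    exact hTC x
  have hcont {F : Type} [NormedAddCommGroup F] {g : E → F} (hg : Continuous g) (l : Λ) :
      Continuous fun x => g (w x + T x l) := by fun_prop
  have hint {F G : Type} [NormedAddCommGroup F] [NormedSpace ℝ F] [NormedAddCommGroup G]
      [NormedSpace ℝ G] {f : E → F} {B : X → F →L[ℝ] G} (hf : Continuous f) (hB : Continuous B)
      (hBi : Integrable B μ) (l : Λ) : Integrable (fun x => B x (f (w x + T x l))) μ := by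
    obtain ⟨D, hD⟩ := hbound hf ‖l‖
    refine (hBi.norm.mul_const D).mono'
      (hB.clm_apply (hcont hf l)).aestronglyMeasurable ?_
    exact .of_forall fun x => ((B x).le_opNorm _).trans (by gcongr; exact hD l le_rfl x)
  let B' {F G : Type} [NormedAddCommGroup F] [NormedSpace ℝ F] [NormedAddCommGroup G]
      [NormedSpace ℝ G] (B : X → F →L[ℝ] G) (x : X) : (E →L[ℝ] F) →L[ℝ] (Λ →L[ℝ] G) :=
    (ContinuousLinearMap.compL ℝ Λ F G (B x)).comp
      ((ContinuousLinearMap.compL ℝ Λ E F).flip (T x))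
  have hB'cont {F G : Type} [NormedAddCommGroup F] [NormedSpace ℝ F] [NormedAddCommGroup G]
      [NormedSpace ℝ G] {B : X → F →L[ℝ] G} (hB : Continuous B) : Continuous (B' B) :=
    ((ContinuousLinearMap.compL ℝ Λ F G).continuous.comp hB).clm_comp
      ((ContinuousLinearMap.compL ℝ Λ E F).flip.continuous.comp hT)
  have hB'int {F G : Type} [NormedAddCommGroup F] [NormedSpace ℝ F] [NormedAddCommGroup G]
      [NormedSpace ℝ G] {B : X → F →L[ℝ] G} (hB : Continuous B) (hBi : Integrable B μ) :
      Integrable (B' B) μ := by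
    refine (hBi.norm.mul_const C).mono' (hB'cont hB).aestronglyMeasurable (.of_forall fun x => ?_)
    refine ContinuousLinearMap.opNorm_le_bound _
      (mul_nonneg (norm_nonneg _) ((norm_nonneg _).trans (hTC x))) fun A => ?_
    calc ‖(B x).comp (A.comp (T x))‖ ≤ ‖B x‖ * (‖A‖ * ‖T x‖) :=
          (ContinuousLinearMap.opNorm_comp_le _ _).trans
            (by gcongr; exact ContinuousLinearMap.opNorm_comp_le _ _)
      _ ≤ ‖B x‖ * (‖A‖ * C) := by gcongr; exact hTC x
      _ = ‖B x‖ * C * ‖A‖ := by ring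
  have hderiv {F G : Type} [NormedAddCommGroup F] [NormedSpace ℝ F] [NormedAddCommGroup G]
      [NormedSpace ℝ G] {f : E → F} {B : X → F →L[ℝ] G} (hf : ContDiff ℝ ∞ f)
      (hB : Continuous B) (hBi : Integrable B μ) (l₀ : Λ) :
      HasFDerivAt (fun l => ∫ x, B x (f (w x + T x l)) ∂μ)
        (∫ x, B' B x (fderiv ℝ f (w x + T x l₀)) ∂μ) l₀ := by
    have hf' : Continuous (fderiv ℝ f) := hf.continuous_fderiv (by simp)
    obtain ⟨D, hD⟩ := hbound hf' (‖l₀‖ + 1)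
    refine hasFDerivAt_integral_of_dominated_of_fderiv_le (Metric.ball_mem_nhds l₀ one_pos)
      (.of_forall fun l => (hB.clm_apply (hcont hf.continuous l)).aestronglyMeasurable)
      (hint hf.continuous hB hBi l₀)
      ((hB'cont hB).clm_apply (hcont hf' l₀)).aestronglyMeasurable
      (F' := fun l x => B' B x (fderiv ℝ f (w x + T x l)))
      (bound := fun x => ‖B' B x‖ * D) (.of_forall fun x l hl => ?_)
      ((hB'int hB hBi).norm.mul_const D) (.of_forall fun x l _ => ?_)
    · refine ((B' B x).le_opNorm _).trans ?_
      gcongr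
      refine hD l ?_ x
      have := norm_sub_norm_le l l₀
      rw [Metric.mem_ball, dist_eq_norm] at hl
      linarith
    · have h1 : HasFDerivAt (fun l => w x + T x l) (T x) l := (T x).hasFDerivAt.const_add _
      exact (B x).hasFDerivAt.comp l
        ((hf.differentiable (by simp) (w x + T x l)).hasFDerivAt.comp l h1)
  induction k with
  | zero =>
    intro F G _ _ _ _ f B hf hB hBi
    exact contDiff_zero.mpr
      (continuous_iff_continuousAt.mpr fun l => (hderiv hf hB hBi l).continuousAt)
  | succ k ih =>
    intro F G _ _ _ _ f B hf hB hBi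
    exact contDiff_succ_iff_hasFDerivAt.mpr ⟨_, ih (hf.fderiv_right (by simp)) (hB'cont hB)
      (hB'int hB hBi), hderiv hf hB hBi⟩

end ParametricIntegral

section SmoothExtension

open scoped Gradient

/-- For smooth `f`, the integral of `f` over `K + ∑ i, l i • B i` is the restriction to the
orthant of a smooth function of `l`. -/
lemma exists_contDiff_eq_setIntegral {n : ℕ} {ι : Type} [Fintype ι]
    {f : Euc n → ℂ} (hf : ContDiff ℝ ∞ f) (K : ConvexBody (Euc n)) (B : ι → ConvexBody (Euc n)) :
    ∃ G : (ι → ℝ) → ℂ, ContDiff ℝ ∞ G ∧ ∀ l : ι → ℝ, (∀ i, 0 ≤ l i) →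
      ∫ y in ((K : Set (Euc n)) + ∑ i, l i • (B i : Set (Euc n))), f y = G l := by
  classical
  have hpot (K : ConvexBody (Euc n)) : ∃ φ, IsGradientPotential (K : Set (Euc n)) φ :=
    exists_isGradientPotential K.isCompact K.nonempty K.convex
  obtain ⟨φ, hφ⟩ := hpot K
  choose ψ hψ using fun i => hpot (B i)
  have hsum {l : ι → ℝ} (hl : ∀ i, 0 ≤ l i) :
      IsGradientPotential ((K : Set (Euc n)) + ∑ i, l i • (B i : Set (Euc n)))
        (φ + ∑ i, l i • ψ i) :=
    hφ.add (IsGradientPotential.sum _ fun i => (hψ i).smul (hl i))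
  let T (x : Euc n) : (ι → ℝ) →L[ℝ] Euc n :=
    ∑ i, (ContinuousLinearMap.proj i : (ι → ℝ) →L[ℝ] ℝ).smulRight (∇ (ψ i) x)
  have hTapply (x : Euc n) (l : ι → ℝ) : T x l = ∑ i, l i • ∇ (ψ i) x := by
    simp [T]
  have hgrad (l : ι → ℝ) : ∇ (φ + ∑ i, l i • ψ i) = fun x => ∇ φ x + T x l := by
    refine gradient_eq fun x => ?_
    rw [hasGradientAt_iff_hasFDerivAt, hTapply, map_add, map_sum]
    refine (hφ.differentiable x).hasGradientAt.hasFDerivAt.add (HasFDerivAt.sum fun i _ => ?_)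
    rw [map_smul]
    exact ((hψ i).differentiable x).hasGradientAt.hasFDerivAt.const_smul (l i)
  let D (x : Euc n) (l : ι → ℝ) : ℝ :=
    (fderiv ℝ (∇ φ) x + ∑ i, l i • fderiv ℝ (∇ (ψ i)) x).det
  have hfderiv (l : ι → ℝ) (x : Euc n) :
      (fderiv ℝ (∇ (φ + ∑ i, l i • ψ i)) x).det = D x l := by
    have : HasFDerivAt (fun x => ∇ φ x + T x l)
        (fderiv ℝ (∇ φ) x + ∑ i, l i • fderiv ℝ (∇ (ψ i)) x) x := by
      simp only [hTapply]
      exact (hφ.hasFDerivAt_gradient x).add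
        (HasFDerivAt.fun_sum fun i _ => ((hψ i).hasFDerivAt_gradient x).const_smul (l i))
    rw [hgrad, this.fderiv]
  have hDcont (l : ι → ℝ) : Continuous fun x => D x l := by
    refine ContinuousLinearMap.continuous_det.comp
      ((hφ.contDiff_gradient.continuous_fderiv (by simp)).add
      (continuous_finsetSum _ fun i _ => ?_))
    exact ((hψ i).contDiff_gradient.continuous_fderiv (by simp)).const_smul (l i)
  have hDint {l : ι → ℝ} (hl : ∀ i, 0 ≤ l i) : Integrable fun x => D x l := by
    simpa only [hfderiv] using (hsum hl).integrable_det volume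
  obtain ⟨κ, _, N, L, hN, hL, hinterp⟩ :=
    exists_interpolation ι (Module.finrank ℝ (Euc n) + 1)
  have hD (x : Euc n) (l : ι → ℝ) : D x l = ∑ k, L k l * D x (N k) := by
    exact hinterp (D x) (exists_polynomial_det_add_sum _ _) l
  have hwcont : Continuous (∇ φ) := hφ.contDiff_gradient.continuous
  have hTcont : Continuous T := by
    refine continuous_finsetSum _ fun i _ => ?_
    exact (ContinuousLinearMap.smulRightL ℝ (ι → ℝ) (Euc n)
      (ContinuousLinearMap.proj i)).continuous.comp (hψ i).contDiff_gradient.continuous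
  obtain ⟨C, hwC, hTC⟩ : ∃ C, (∀ x, ‖∇ φ x‖ ≤ C) ∧ ∀ x, ‖T x‖ ≤ C := by
    obtain ⟨C₀, hC₀⟩ := K.isCompact.isBounded.exists_norm_le
    choose C₁ hC₁ using fun i => (B i).isCompact.isBounded.exists_norm_le
    refine ⟨max C₀ (∑ i, ‖(ContinuousLinearMap.proj i : (ι → ℝ) →L[ℝ] ℝ)‖ * C₁ i),
      fun x => (hC₀ _ (hφ.gradient_mem x)).trans (le_max_left _ _),
      fun x => le_trans ?_ (le_max_right _ _)⟩
    refine norm_sum_le_of_le _ fun i _ => ?_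
    rw [ContinuousLinearMap.norm_smulRight_apply]
    gcongr
    exact hC₁ i _ ((hψ i).gradient_mem x)
  have hBcont (k : κ) : Continuous fun x => D x (N k) • ContinuousLinearMap.id ℝ ℂ :=
    (hDcont _).smul continuous_const
  have hBint (k : κ) : Integrable fun x => D x (N k) • ContinuousLinearMap.id ℝ ℂ :=
    (hDint (hN k)).smul_const _
  refine ⟨fun l =>
    ∑ k, L k l • ∫ x, (D x (N k) • ContinuousLinearMap.id ℝ ℂ) (f (∇ φ x + T x l)),
    ?_, fun l hl => ?_⟩
  · refine ContDiff.sum fun k _ => (hL k).smul (contDiff_infty.mpr fun m => ?_)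
    exact contDiff_integral_comp_affine hwcont hTcont hwC hTC m hf (hBcont k) (hBint k)
  · rw [(hsum hl).setIntegral_eq volume f]
    simp_rw [hfderiv, hgrad, hD _ l, Finset.sum_smul, mul_smul]
    obtain ⟨M, hM⟩ := (hsum hl).isCompact.exists_bound_of_continuousOn hf.continuous.continuousOn
    have hint (k : κ) : Integrable fun x => D x (N k) • f (∇ φ x + T x l) := by
      refine ((hDint (hN k)).norm.mul_const M).mono' ((hDcont _).smul
        (hf.continuous.comp (by fun_prop))).aestronglyMeasurable (.of_forall fun x => ?_)
      rw [norm_smul]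
      gcongr
      refine hM _ ?_
      have := (hsum hl).gradient_mem x
      rwa [hgrad] at this
    refine (integral_finsetSum _ fun k _ => (hint k).smul (L k l)).trans ?_
    exact Finset.sum_congr rfl fun k _ => integral_smul (L k l) _

end SmoothExtension

section MixedPartial

variable {s : ℕ} {F : Type*} [NormedAddCommGroup F] [NormedSpace ℝ F]

/-- The two-sided partial derivative in the `i`-th coordinate. -/
def coordDeriv (G : (Fin s → ℝ) → F) (i : Fin s) : (Fin s → ℝ) → F :=
  fun l => fderiv ℝ G l (Pi.single i 1)

lemma ContDiff.coordDeriv {G : (Fin s → ℝ) → F} (hG : ContDiff ℝ ∞ G) (i : Fin s) :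
    ContDiff ℝ ∞ (coordDeriv G i) :=
  (hG.fderiv_right (by simp)).clm_apply contDiff_const

lemma pderivOrth_eq_coordDeriv {g G : (Fin s → ℝ) → F} (hG : ContDiff ℝ ∞ G)
    (h : ∀ l, (∀ i, 0 ≤ l i) → g l = G l) (i : Fin s) (l : Fin s → ℝ) (hl : ∀ i, 0 ≤ l i) :
    pderivOrth g i l = coordDeriv G i l := by
  have hder : HasDerivAt (fun t => G (Function.update l i t)) (coordDeriv G i l) (l i) := by
    refine HasFDerivAt.comp_hasDerivAt (l i) ?_ (hasDerivAt_update l i (l i))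
    rw [Function.update_eq_self]
    exact (hG.differentiable (by simp) l).hasFDerivAt
  have hnonneg : ∀ t ∈ Ici (0 : ℝ), ∀ j, 0 ≤ Function.update l i t j := by
    intro t ht j
    rcases eq_or_ne j i with rfl | hj
    · simpa using ht
    · simpa [hj] using hl j
  exact (hder.hasDerivWithinAt.congr (fun t ht => h _ (hnonneg t ht))
    (h _ (hnonneg _ (hl i)))).derivWithin (uniqueDiffOn_Ici 0 _ (hl i))

lemma foldl_pderivOrth_eq (is : List (Fin s)) : ∀ {g G : (Fin s → ℝ) → F}, ContDiff ℝ ∞ G →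
    (∀ l, (∀ i, 0 ≤ l i) → g l = G l) →
    ∀ l, (∀ i, 0 ≤ l i) → is.foldl pderivOrth g l = is.foldl coordDeriv G l := by
  induction is with
  | nil => exact fun _ h => h
  | cons i is ih =>
    exact fun hG h => ih (hG.coordDeriv i) (pderivOrth_eq_coordDeriv hG h i)

lemma foldl_coordDeriv_eq_of_eqOn_hyperplane {i₀ : Fin s} (a b : ℂ) (is : List (Fin s))
    (his : i₀ ∉ is) : ∀ {G G₁ G₂ : (Fin s → ℝ) → ℂ}, ContDiff ℝ ∞ G → ContDiff ℝ ∞ G₁ →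
    ContDiff ℝ ∞ G₂ → (∀ l, l i₀ = 0 → G l = a * G₁ l + b * G₂ l) →
    ∀ l, l i₀ = 0 → is.foldl coordDeriv G l =
      a * is.foldl coordDeriv G₁ l + b * is.foldl coordDeriv G₂ l := by
  induction is with
  | nil => exact fun _ _ _ h => h
  | cons i is ih =>
    rw [List.mem_cons, not_or] at his
    intro G G₁ G₂ hG hG₁ hG₂ h
    refine ih his.2 (hG.coordDeriv i) (hG₁.coordDeriv i) (hG₂.coordDeriv i) fun l hl => ?_
    have hline {H : (Fin s → ℝ) → ℂ} (hH : ContDiff ℝ ∞ H) :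
        HasDerivAt (fun t : ℝ => H (l + t • Pi.single i 1)) (coordDeriv H i l) 0 :=
      (hH.differentiable (by simp) l).hasFDerivAt.hasLineDerivAt _
    refine (hline hG).unique ?_
    convert ((hline hG₁).const_mul a).add ((hline hG₂).const_mul b) using 1
    ext t
    exact h _ (by simp [hl, his.1])

end MixedPartial

/-- The linear map sending `l` to `(α * l 0, l 1, …, l m)` together with `β * l 0` in the extra
coordinate. -/
def splitFirst (m : ℕ) (α β : ℝ) : (Fin (m + 1) → ℝ) →L[ℝ] (Option (Fin (m + 1)) → ℝ) :=
  ContinuousLinearMap.pi fun o => o.elim (β • ContinuousLinearMap.proj 0)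
    (Fin.cases (α • ContinuousLinearMap.proj 0) fun i => ContinuousLinearMap.proj i.succ)

section SplitFirst

variable {m : ℕ} (α β : ℝ) (l : Fin (m + 1) → ℝ)

@[simp] lemma splitFirst_none : splitFirst m α β l none = β * l 0 := rfl

@[simp] lemma splitFirst_some_zero : splitFirst m α β l (some 0) = α * l 0 := rfl

@[simp] lemma splitFirst_some_succ (i : Fin m) :
    splitFirst m α β l (some i.succ) = l i.succ := rfl

variable {α β l} in
lemma splitFirst_nonneg (hα : 0 ≤ α) (hβ : 0 ≤ β) (hl : ∀ i, 0 ≤ l i)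
    (o : Option (Fin (m + 1))) : 0 ≤ splitFirst m α β l o := by
  rcases o with _ | i
  · exact mul_nonneg hβ (hl 0)
  · refine Fin.cases ?_ (fun i => ?_) i
    · exact mul_nonneg hα (hl 0)
    · exact hl i.succ

variable {l} in
lemma splitFirst_eq_of_zero (hl : l 0 = 0) : splitFirst m α β l = splitFirst m 0 0 l := by
  ext o
  rcases o with _ | i
  · simp [hl]
  · refine Fin.cases ?_ (fun i => ?_) i <;> simp [hl]

lemma splitFirst_single_zero : splitFirst m α β (Pi.single 0 1) =
    α • splitFirst m 1 0 (Pi.single 0 1) + β • splitFirst m 0 1 (Pi.single 0 1) := by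
  ext o
  rcases o with _ | i
  · simp
  · refine Fin.cases ?_ (fun i => ?_) i <;> simp

lemma sum_smul_update_zero {n : ℕ} (A' A'' : ConvexBody (Euc n))
    (A : Fin (m + 1) → ConvexBody (Euc n)) :
    ∑ i, l i • Function.update (fun i => (A i : Set (Euc n))) 0
        (α • (A' : Set (Euc n)) + β • (A'' : Set (Euc n))) i =
      ∑ o : Option (Fin (m + 1)), splitFirst m α β l o •
        ((o.elim A'' (Function.update A 0 A') : ConvexBody (Euc n)) : Set (Euc n)) := by
  rw [Fintype.sum_option, Fin.sum_univ_succ, Fin.sum_univ_succ]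
  simp only [Function.update_self, Option.elim, splitFirst_none, splitFirst_some_zero,
    splitFirst_some_succ, Function.update_of_ne (Fin.succ_ne_zero _)]
  rw [smul_add, smul_smul, smul_smul, mul_comm α, mul_comm β]
  abel

end SplitFirst

/-- Minkowski additivity of the mixed derivative `∂^s/∂λ |₀ ∫_{K + λ₁A₁ + Σ_{i≥2} λᵢAᵢ} f`
in its first body argument: replacing `A₁` by a Minkowski combination `aA' + bA''` gives the
corresponding linear combination. -/
theorem mixed_derivative_minkowski_additive {n : ℕ} (hn : 1 ≤ n)
    (s : ℕ) (hs : 1 ≤ s) (f : Euc n → ℂ) (hf : ContDiff ℝ ∞ f)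
    (K A' A'' : ConvexBody (Euc n)) (A : Fin s → ConvexBody (Euc n))
    (a b : ℝ) (ha : 0 ≤ a) (hb : 0 ≤ b) :
    mixedPartialAtZero (fun lam : Fin s → ℝ =>
        ∫ y in ((K : Set (Euc n)) + ∑ i, lam i •
          Function.update (fun i => (A i : Set (Euc n))) ⟨0, hs⟩
            (a • (A' : Set (Euc n)) + b • (A'' : Set (Euc n))) i), f y)
      = (a : ℂ) * mixedPartialAtZero (fun lam : Fin s → ℝ =>
        ∫ y in ((K : Set (Euc n)) + ∑ i, lam i •
          Function.update (fun i => (A i : Set (Euc n))) ⟨0, hs⟩ (A' : Set (Euc n)) i), f y)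
      + (b : ℂ) * mixedPartialAtZero (fun lam : Fin s → ℝ =>
        ∫ y in ((K : Set (Euc n)) + ∑ i, lam i •
          Function.update (fun i => (A i : Set (Euc n))) ⟨0, hs⟩ (A'' : Set (Euc n)) i), f y) := by
  obtain ⟨m, rfl⟩ : ∃ m, s = m + 1 := ⟨s - 1, by omega⟩
  have hfst : (⟨0, hs⟩ : Fin (m + 1)) = 0 := rfl
  simp only [hfst]
  have hA' : (A' : Set (Euc n)) = (1 : ℝ) • (A' : Set (Euc n)) + (0 : ℝ) • (A'' : Set (Euc n)) := by
    rw [one_smul, Set.zero_smul_set A''.nonempty, add_zero]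
  have hA'' : (A'' : Set (Euc n)) =
      (0 : ℝ) • (A' : Set (Euc n)) + (1 : ℝ) • (A'' : Set (Euc n)) := by
    rw [one_smul, Set.zero_smul_set A'.nonempty, zero_add]
  obtain ⟨G, hG, hGeq⟩ := exists_contDiff_eq_setIntegral hf K
    (fun o : Option (Fin (m + 1)) => o.elim A'' (Function.update A 0 A'))
  have hsmooth (α β : ℝ) : ContDiff ℝ ∞ (fun l => G (splitFirst m α β l)) :=
    hG.comp (splitFirst m α β).contDiff
  have hmixed {α β : ℝ} (hα : 0 ≤ α) (hβ : 0 ≤ β) :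
      mixedPartialAtZero (fun lam : Fin (m + 1) → ℝ =>
        ∫ y in ((K : Set (Euc n)) + ∑ i, lam i •
          Function.update (fun i => (A i : Set (Euc n))) 0
            (α • (A' : Set (Euc n)) + β • (A'' : Set (Euc n))) i), f y) =
      ((List.finRange m).map Fin.succ).foldl coordDeriv
        (coordDeriv (fun l => G (splitFirst m α β l)) 0) 0 := by
    rw [mixedPartialAtZero, foldl_pderivOrth_eq _ (hsmooth α β) (fun l hl => ?_) 0 fun _ => le_rfl,
      List.finRange_succ, List.foldl_cons]
    rw [sum_smul_update_zero]
    exact hGeq _ (splitFirst_nonneg hα hβ hl)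
  have hone := hmixed zero_le_one le_rfl
  have htwo := hmixed le_rfl zero_le_one
  rw [← hA'] at hone
  rw [← hA''] at htwo
  rw [hmixed ha hb, hone, htwo]
  refine foldl_coordDeriv_eq_of_eqOn_hyperplane (i₀ := 0) (a : ℂ) (b : ℂ) _
    (by simp [Fin.succ_ne_zero]) ((hsmooth a b).coordDeriv 0) ((hsmooth 1 0).coordDeriv 0)
    ((hsmooth 0 1).coordDeriv 0) (fun l hl => ?_) 0 rfl
  have hderiv (α β : ℝ) : coordDeriv (fun l => G (splitFirst m α β l)) 0 l =
      fderiv ℝ G (splitFirst m 0 0 l) (splitFirst m α β (Pi.single 0 1)) := by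
    have h1 := (hG.differentiable (by simp) (splitFirst m α β l)).hasFDerivAt.comp l
      (splitFirst m α β).hasFDerivAt
    rw [splitFirst_eq_of_zero α β hl] at h1
    exact congrArg (· (Pi.single 0 1)) h1.fderiv
  rw [hderiv, hderiv, hderiv, splitFirst_single_zero a b, map_add, map_smul, map_smul,
    Complex.real_smul, Complex.real_smul]
end
end

section
/- Let n ≥ 1, let d ≥ 0, and let φ be a continuous valuation on 𝒦(ℝⁿ) which is polynomial of degree at most d, i.e., for every convex body K the function ℝⁿ → ℂ, x ↦ φ(K + x), agrees with a polynomial map of total degree at most d. Then for any convex bodies K_1, …, K_s in ℝⁿ there exists a polynomial p ∈ ℂ[λ_1, …, λ_s] of total degree at most d + n such that φ(λ_1 K_1 + ⋯ + λ_s K_s) = p(λ_1, …, λ_s) for all λ_1, …, λ_s ≥ 0. -/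
open scoped Pointwise ContDiff
open MeasureTheory Set Filter

noncomputable section

section ForwardDifferences

variable {M G : Type*} [AddCommMonoid M] [AddCommGroup G]

/-- The monoid algebra of `M` acts on functions on `M` by translations. -/
def shiftHom (M G : Type*) [AddCommMonoid M] [AddCommGroup G] :
    AddMonoidAlgebra ℤ M →ₐ[ℤ] Module.End ℤ (M → G) :=
  AddMonoidAlgebra.lift ℤ _ M
    { toFun := fun a => fwdDiff_aux.shiftₗ M G a.toAdd
      map_one' := by
        ext f y
        simp [fwdDiff_aux.shiftₗ_apply]
      map_mul' := fun a b => by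
        ext f y
        simp [fwdDiff_aux.shiftₗ_apply, add_assoc, Module.End.mul_apply, -map_add] }

lemma shiftHom_single (a : M) (f : M → G) (y : M) :
    shiftHom M G (AddMonoidAlgebra.single a 1) f y = f (y + a) := by
  simp [shiftHom, fwdDiff_aux.shiftₗ_apply]

lemma shiftHom_sub_one_pow (a : M) (f : M → G) (k : ℕ) :
    shiftHom M G ((AddMonoidAlgebra.single a 1 - 1) ^ k) f = (fwdDiff a)^[k] f := by
  have h : shiftHom M G (AddMonoidAlgebra.single a 1 - 1) = fwdDiff_aux.fwdDiffₗ M G a := by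
    ext g y
    rw [map_sub, map_one, LinearMap.sub_apply, Pi.sub_apply, shiftHom_single]
    simp [fwdDiff_aux.fwdDiffₗ, fwdDiff]
  rw [map_pow, h, ← fwdDiff_aux.coe_fwdDiffₗ, Module.End.pow_apply]

/-- The ideal of the monoid algebra consisting of the operators that annihilate `f`. -/
def shiftAnnihilator (f : M → G) : Ideal (AddMonoidAlgebra ℤ M) where
  carrier := {r | shiftHom M G r f = 0}
  add_mem' {a b} ha hb := by
    simp only [Set.mem_ofPred_eq] at *
    rw [map_add, LinearMap.add_apply, ha, hb, add_zero]
  zero_mem' := by simp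
  smul_mem' c x hx := by
    simp only [Set.mem_ofPred_eq] at *
    rw [smul_eq_mul, map_mul, Module.End.mul_apply, hx, map_zero]

lemma mem_shiftAnnihilator {f : M → G} {r : AddMonoidAlgebra ℤ M} :
    r ∈ shiftAnnihilator f ↔ shiftHom M G r f = 0 := Iff.rfl

lemma sub_one_pow_mem_shiftAnnihilator {f : M → G} {a : M} {k : ℕ} :
    (AddMonoidAlgebra.single a 1 - 1) ^ k ∈ shiftAnnihilator f ↔ (fwdDiff a)^[k] f = 0 := by
  rw [mem_shiftAnnihilator, shiftHom_sub_one_pow]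

lemma single_one_nsmul (a : M) (k : ℕ) :
    (AddMonoidAlgebra.single (k • a) 1 : AddMonoidAlgebra ℤ M) =
      AddMonoidAlgebra.single a 1 ^ k := by
  simp [AddMonoidAlgebra.single_pow]

lemma fwdDiff_iter_eq_zero_mono {f : M → G} {a : M} {j k : ℕ} (hjk : j ≤ k)
    (h : (fwdDiff a)^[j] f = 0) : (fwdDiff a)^[k] f = 0 := by
  rw [← sub_one_pow_mem_shiftAnnihilator] at h ⊢
  exact Ideal.mem_of_dvd _ (pow_dvd_pow _ hjk) h

/-- If the product of the operators translate by `P` minus translate by `v i` annihilates `f`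
and some power of each translate by `v i` minus identity annihilates `f`, then some power of
translate by `P` minus identity annihilates `f`. -/
lemma exists_fwdDiff_iter_eq_zero {m k : ℕ} (f : M → G) (P : M) (v : Fin m → M)
    (hprod : ∀ A : M, ∑ T : Finset (Fin m),
      (-1 : ℤ) ^ T.card • f (A + ((m - T.card) • P + ∑ i ∈ T, v i)) = 0)
    (hv : ∀ i, (fwdDiff (v i))^[k] f = 0) : ∃ N, (fwdDiff P)^[N] f = 0 := by
  set x : AddMonoidAlgebra ℤ M := AddMonoidAlgebra.single P 1 with hx
  set y : Fin m → AddMonoidAlgebra ℤ M := fun i => AddMonoidAlgebra.single (v i) 1 with hy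
  have hmem : ∏ i, (x - y i) ∈ shiftAnnihilator f := by
    have hterm : ∏ i, (x - y i) = ∑ T : Finset (Fin m), (-1 : ℤ) ^ T.card •
        (AddMonoidAlgebra.single ((m - T.card) • P + ∑ i ∈ T, v i) 1 : AddMonoidAlgebra ℤ M) := by
      rw [Finset.prod_sub, Finset.powerset_univ]
      refine Finset.sum_congr rfl fun T _ => ?_
      have h1 : ∏ i ∈ T, y i = AddMonoidAlgebra.single (∑ i ∈ T, v i) 1 := by
        simp [hy, AddMonoidAlgebra.prod_single]
      rw [Finset.prod_const, h1, ← Finset.compl_eq_univ_sdiff, Finset.card_compl, Fintype.card_fin,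
        hx, ← single_one_nsmul, mul_assoc, AddMonoidAlgebra.single_mul_single, one_mul,
        zsmul_eq_mul]
      push_cast
      rfl
    rw [mem_shiftAnnihilator, hterm]
    ext A
    have := hprod A
    simp only [map_sum, map_zsmul, LinearMap.sum_apply, LinearMap.smul_apply, Finset.sum_apply,
      Pi.smul_apply, shiftHom_single, Pi.zero_apply]
    exact this
  have hyrad : ∀ i, y i - 1 ∈ (shiftAnnihilator f).radical := fun i =>
    ⟨k, sub_one_pow_mem_shiftAnnihilator.2 (hv i)⟩
  have hxrad : x - 1 ∈ (shiftAnnihilator f).radical := by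
    rw [← Ideal.radical_idem]
    refine ⟨m, ?_⟩
    have h1 := Ideal.le_radical hmem
    rw [← Ideal.Quotient.eq_zero_iff_mem] at h1 ⊢
    rw [← h1, map_pow, map_prod]
    have h2 : ∀ i, Ideal.Quotient.mk (shiftAnnihilator f).radical (x - y i) =
        Ideal.Quotient.mk (shiftAnnihilator f).radical (x - 1) := fun i => by
      rw [← sub_eq_zero, ← map_sub, Ideal.Quotient.eq_zero_iff_mem]
      have := (shiftAnnihilator f).radical.neg_mem (hyrad i)
      convert this using 1
      ring
    simp [h2]
  obtain ⟨N, hN⟩ := hxrad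
  exact ⟨N, sub_one_pow_mem_shiftAnnihilator.1 hN⟩

/-- If the difference of order `j + 1` vanishes, the difference of order `j` is homogeneous of
degree `j` in the step. -/
lemma fwdDiff_iter_nsmul_step {j : ℕ} {f : M → G} {P : M} (hf : (fwdDiff P)^[j + 1] f = 0) (h : ℕ) :
    (fwdDiff (h • P))^[j] f = (h ^ j) • (fwdDiff P)^[j] f := by
  set x : AddMonoidAlgebra ℤ M := AddMonoidAlgebra.single P 1 with hx
  have hmem := sub_one_pow_mem_shiftAnnihilator.2 hf
  have h1 : (x ^ h - 1) = (x - 1) * ∑ i ∈ Finset.range h, x ^ i := (mul_geom_sum x h).symm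
  have h2 : (x - 1) ∣ (∑ i ∈ Finset.range h, x ^ i) - h := by
    have : (∑ i ∈ Finset.range h, x ^ i) - h = ∑ i ∈ Finset.range h, (x ^ i - 1) := by simp
    rw [this]
    exact Finset.dvd_sum fun i _ => by simpa using sub_dvd_pow_sub_pow x 1 i
  have h3 : (x ^ h - 1) ^ j - (h : AddMonoidAlgebra ℤ M) ^ j * (x - 1) ^ j ∈
      shiftAnnihilator f := by
    refine Ideal.mem_of_dvd _ ?_ hmem
    rw [h1, mul_pow, mul_comm _ ((x - 1) ^ j), ← mul_sub, pow_succ]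
    exact mul_dvd_mul_left _ (h2.trans (sub_dvd_pow_sub_pow _ _ j))
  rw [mem_shiftAnnihilator, hx, ← single_one_nsmul, map_sub, LinearMap.sub_apply,
    shiftHom_sub_one_pow, map_mul, Module.End.mul_apply, shiftHom_sub_one_pow, sub_eq_zero,
    map_pow, map_natCast] at h3
  rw [h3, ← Nat.cast_pow, Module.End.natCast_apply]

lemma norm_fwdDiff_iter_le {E : Type*} [NormedAddCommGroup E] [NormedSpace ℝ E] (f : M → E)
    (P A : M) (n : ℕ) {C : ℝ} (hC : ∀ k ≤ n, ‖f (A + k • P)‖ ≤ C) :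
    ‖(fwdDiff P)^[n] f A‖ ≤ 2 ^ n * C := by
  rw [fwdDiff_iter_eq_sum_shift]
  calc _ ≤ ∑ k ∈ Finset.range (n + 1), (n.choose k : ℝ) * C := by
        refine norm_sum_le_of_le _ fun k hk => ?_
        rw [← Int.cast_smul_eq_zsmul ℝ, norm_smul]
        have : ‖(((-1 : ℤ) ^ (n - k) * n.choose k : ℤ) : ℝ)‖ = n.choose k := by
          push_cast
          simp
        rw [this]
        exact mul_le_mul_of_nonneg_left (hC k (by simpa [Nat.lt_succ_iff] using hk)) (by positivity)
    _ = 2 ^ n * C := by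
        rw [← Finset.sum_mul]
        exact_mod_cast congrArg (fun z : ℕ => (z : ℝ) * C) (Nat.sum_range_choose n)

/-- A function with vanishing higher differences and growth of order `D` has vanishing differences
of order `D + 1`. -/
lemma fwdDiff_iter_eq_zero_of_growth {E : Type*} [NormedAddCommGroup E] [NormedSpace ℝ E]
    {f : M → E} {P : M} {D N : ℕ} (hN : (fwdDiff P)^[N] f = 0)
    (hgrow : ∀ A, ∃ C : ℝ, ∀ k : ℕ, ‖f (A + k • P)‖ ≤ C * (k + 1) ^ D) :
    (fwdDiff P)^[D + 1] f = 0 := by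
  suffices h : ∀ i, (fwdDiff P)^[D + 1 + i] f = 0 → (fwdDiff P)^[D + 1] f = 0 from
    h N (fwdDiff_iter_eq_zero_mono (by omega) hN)
  intro i
  induction i with
  | zero => exact id
  | succ i ih =>
    refine fun hi => ih ?_
    set j := D + 1 + i with hj
    funext A
    obtain ⟨C, hC⟩ := hgrow A
    have hC0 : 0 ≤ C := by simpa using (norm_nonneg _).trans (hC 0)
    set c := ‖(fwdDiff P)^[j] f A‖ with hc
    set B := 2 ^ j * (C * (j + 1) ^ D) with hB
    have key : ∀ h : ℕ, 1 ≤ h → (h : ℝ) * c ≤ B := by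
      intro h hh
      have hh' : (1 : ℝ) ≤ h := by exact_mod_cast hh
      have e := congrFun (fwdDiff_iter_nsmul_step (j := j) hi h) A
      have b := norm_fwdDiff_iter_le f (h • P) A j (C := C * ((j + 1) * h) ^ D) (by
        intro k hk
        rw [smul_smul]
        refine (hC _).trans ?_
        have : (k : ℝ) ≤ j := by exact_mod_cast hk
        push_cast
        gcongr
        nlinarith)
      rw [e, Pi.smul_apply, ← Nat.cast_smul_eq_nsmul ℝ, norm_smul, ← hc] at b
      have hpos : (0 : ℝ) < (h : ℝ) ^ D := by positivity
      refine le_of_mul_le_mul_left ?_ hpos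
      calc (h : ℝ) ^ D * (h * c) = (h : ℝ) ^ (D + 1) * c := by ring
        _ ≤ (h : ℝ) ^ j * c := by
            gcongr
            omega
        _ ≤ _ := by
            refine le_trans (le_of_eq ?_) (b.trans (le_of_eq ?_))
            · simp
            · rw [hB, mul_pow]; ring
    have hc0 : c ≤ 0 := by
      by_contra! hpos
      obtain ⟨h, hh⟩ := exists_nat_gt (B / c)
      rw [div_lt_iff₀ hpos] at hh
      have := key (h + 1) (by omega)
      push_cast at this
      nlinarith
    exact norm_le_zero_iff.1 hc0

end ForwardDifferences

section BodyMetric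

variable {V : Type*} [NormedAddCommGroup V] [NormedSpace ℝ V]

open TopologicalSpace in
/-- A convex body as a nonempty compact set. -/
def ConvexBody.toNonemptyCompacts (K : ConvexBody V) : NonemptyCompacts V :=
  ⟨⟨K, K.isCompact⟩, K.nonempty⟩

lemma ConvexBody.dist_le_of_forall {K L : ConvexBody V} {r : ℝ} (hr : 0 ≤ r)
    (h₁ : ∀ x ∈ K, ∃ y ∈ L, dist x y ≤ r) (h₂ : ∀ x ∈ L, ∃ y ∈ K, dist x y ≤ r) :
    dist K L ≤ r :=
  Metric.hausdorffDist_le_of_mem_dist hr h₁ h₂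

lemma ConvexBody.exists_dist_lt {K L : ConvexBody V} {r : ℝ} (h : dist K L < r) {x : V}
    (hx : x ∈ K) : ∃ y ∈ L, dist x y < r :=
  Metric.exists_dist_lt_of_hausdorffDist_lt (s := (K : Set V)) (t := (L : Set V)) hx h
    ConvexBody.hausdorffEDist_ne_top

lemma ConvexBody.dist_add_add_le (K L K' L' : ConvexBody V) :
    dist (K + L) (K' + L') ≤ dist K K' + dist L L' := by
  have key : ∀ (K L K' L' : ConvexBody V) (ε : ℝ), 0 < ε → ∀ x ∈ K + L,
      ∃ y ∈ K' + L', dist x y ≤ dist K K' + dist L L' + ε := by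
    intro K L K' L' ε hε x hx
    obtain ⟨a, ha, b, hb, rfl⟩ := Set.mem_add.1 hx
    obtain ⟨a', ha', haa⟩ := exists_dist_lt (L := K') (r := dist K K' + ε / 2) (by linarith) ha
    obtain ⟨b', hb', hbb⟩ := exists_dist_lt (L := L') (r := dist L L' + ε / 2) (by linarith) hb
    exact ⟨a' + b', Set.add_mem_add ha' hb', (_root_.dist_add_add_le _ _ _ _).trans (by linarith)⟩
  refine le_of_forall_pos_le_add fun ε hε => dist_le_of_forall (by positivity)
    (key K L K' L' ε hε) fun x hx => ?_
  have := key K' L' K L ε hε x hx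
  rwa [dist_comm K', dist_comm L'] at this

instance : ContinuousAdd (ConvexBody V) where
  continuous_add := by
    refine (LipschitzWith.of_dist_le_mul (K := 2) fun p q => ?_).continuous
    refine (ConvexBody.dist_add_add_le _ _ _ _).trans ?_
    rw [Prod.dist_eq]
    have h1 := le_max_left (dist p.1 q.1) (dist p.2 q.2)
    have h2 := le_max_right (dist p.1 q.1) (dist p.2 q.2)
    push_cast
    linarith

lemma ConvexBody.continuous_smul_left (K : ConvexBody V) : Continuous fun t : ℝ => t • K := by
  obtain ⟨C, hC⟩ := K.isBounded.exists_norm_le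
  obtain ⟨x₀, hx₀⟩ := K.nonempty
  have hC0 : 0 ≤ C := (norm_nonneg _).trans (hC x₀ hx₀)
  have key : ∀ t s : ℝ, ∀ x ∈ t • K, ∃ y ∈ s • K, dist x y ≤ C * dist t s := by
    intro t s x hx
    obtain ⟨a, ha, rfl⟩ := Set.mem_smul_set.1 hx
    refine ⟨s • a, Set.smul_mem_smul_set ha, ?_⟩
    rw [dist_eq_norm, ← sub_smul, norm_smul, mul_comm, Real.dist_eq, Real.norm_eq_abs]
    exact mul_le_mul_of_nonneg_right (hC a ha) (abs_nonneg _)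
  refine (LipschitzWith.of_dist_le_mul (K := ⟨C, hC0⟩) fun t s => ?_).continuous
  refine dist_le_of_forall (by positivity) (key t s) ?_
  have := key s t
  rwa [dist_comm s t] at this

lemma ConvexBody.natCast_smul (k : ℕ) (K : ConvexBody V) : (k : ℝ) • K = k • K := by
  have : ((k : NNReal) : ℝ) = k := by simp
  rw [← this, ← Nat.cast_smul_eq_nsmul NNReal]
  exact ConvexBody.ext rfl

/-- Polytopes are dense among convex bodies. -/
lemma ConvexBody.exists_polytope_dist_le (K : ConvexBody V) {ε : ℝ} (hε : 0 < ε) :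
    ∃ (m : ℕ) (v : Fin m → V) (P : ConvexBody V),
      (P : Set V) = convexHull ℝ (Set.range v) ∧ dist P K ≤ ε := by
  obtain ⟨t, htK, htfin, hcov⟩ := K.isCompact.finite_cover_balls hε
  have htne : t.Nonempty := by
    obtain ⟨x, hx⟩ := K.nonempty
    obtain ⟨y, hy, -⟩ := Set.mem_iUnion₂.1 (hcov hx)
    exact ⟨y, hy⟩
  obtain ⟨m, v, -, hv⟩ := htfin.fin_param
  refine ⟨m, v, ⟨convexHull ℝ t, convex_convexHull ℝ t, htfin.isCompact_convexHull ℝ,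
    htne.convexHull⟩, (congrArg (convexHull ℝ) hv).symm, dist_le_of_forall hε.le ?_ ?_⟩
  · exact fun x hx => ⟨x, convexHull_min htK K.convex hx, by simpa using hε.le⟩
  · intro x hx
    obtain ⟨y, hy, hxy⟩ := Set.mem_iUnion₂.1 (hcov hx)
    exact ⟨y, subset_convexHull ℝ t hy, (Metric.mem_ball.1 hxy).le⟩

open TopologicalSpace in
lemma isClosed_setOf_convex_nonemptyCompacts :
    IsClosed {K : NonemptyCompacts V | Convex ℝ (K : Set V)} := by
  refine isClosed_of_closure_subset fun K hK => ?_
  rw [Metric.mem_closure_iff] at hK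
  have hne : ∀ K L : NonemptyCompacts V, Metric.hausdorffEDist (K : Set V) L ≠ ⊤ := fun K L =>
    Metric.hausdorffEDist_ne_top_of_nonempty_of_bounded K.nonempty L.nonempty
      K.isCompact.isBounded L.isCompact.isBounded
  intro x hx y hy a b ha hb hab
  rw [← K.isCompact.isClosed.closure_eq, Metric.mem_closure_iff]
  intro ε hε
  obtain ⟨L, hL, hKL⟩ := hK (ε / 2) (by linarith)
  rw [Metric.NonemptyCompacts.dist_eq] at hKL
  obtain ⟨x', hx', hxx⟩ := Metric.exists_dist_lt_of_hausdorffDist_lt hx hKL (hne K L)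
  obtain ⟨y', hy', hyy⟩ := Metric.exists_dist_lt_of_hausdorffDist_lt hy hKL (hne K L)
  obtain ⟨z, hz, hzz⟩ := Metric.exists_dist_lt_of_hausdorffDist_lt' (hL hx' hy' ha hb hab) hKL
    (hne K L)
  refine ⟨z, hz, ?_⟩
  have h1 : dist (a • x + b • y) (a • x' + b • y') ≤ ε / 2 := by
    refine (dist_add_add_le _ _ _ _).trans ?_
    rw [dist_smul₀, dist_smul₀, Real.norm_of_nonneg ha, Real.norm_of_nonneg hb]
    calc _ ≤ a * (ε / 2) + b * (ε / 2) := by gcongr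
      _ = ε / 2 := by rw [← add_mul, hab, one_mul]
  have h2 := dist_triangle (a • x + b • y) (a • x' + b • y') z
  rw [dist_comm] at hzz
  linarith

lemma ConvexBody.isClosedEmbedding_toNonemptyCompacts :
    Topology.IsClosedEmbedding (toNonemptyCompacts (V := V)) := by
  have hiso : Isometry (toNonemptyCompacts (V := V)) := Isometry.of_dist_eq fun _ _ => rfl
  refine ⟨hiso.isEmbedding, ?_⟩
  convert isClosed_setOf_convex_nonemptyCompacts (V := V)
  ext K
  exact ⟨by rintro ⟨L, rfl⟩; exact L.convex, fun h => ⟨⟨K, h, K.isCompact, K.nonempty⟩, rfl⟩⟩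

/-- **Blaschke selection theorem**: the convex bodies contained in a compact set form a compact
set. -/
lemma ConvexBody.isCompact_setOf_subset {S : Set V} (hS : IsCompact S) :
    IsCompact {K : ConvexBody V | (K : Set V) ⊆ S} :=
  isClosedEmbedding_toNonemptyCompacts.isCompact_preimage
    (TopologicalSpace.NonemptyCompacts.isCompact_subsets_of_isCompact hS)

end BodyMetric

section CutAdditive

/-- A function on sets which vanishes on the empty set and is additive under cutting a compact
convex set by a hyperplane. -/
structure IsCutAdditive {E : Type*} [AddCommGroup E] [Module ℝ E] [TopologicalSpace E]
    (ψ : Set E → ℂ) : Prop where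
  empty : ψ ∅ = 0
  cut : ∀ (f : E →L[ℝ] ℝ) (c : ℝ) (L : Set E), Convex ℝ L → IsCompact L →
    ψ L + ψ (L ∩ {x | f x = c}) = ψ (L ∩ {x | f x ≤ c}) + ψ (L ∩ {x | c ≤ f x})

open Classical in
/-- Extension of a function on convex bodies to all sets, by zero. -/
def bodyValue {n : ℕ} (φ : ConvexBody (Euc n) → ℂ) (S : Set (Euc n)) : ℂ :=
  if h : Convex ℝ S ∧ IsCompact S ∧ S.Nonempty then φ ⟨S, h.1, h.2.1, h.2.2⟩ else 0

lemma bodyValue_coe {n : ℕ} (φ : ConvexBody (Euc n) → ℂ) (K : ConvexBody (Euc n)) :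
    bodyValue φ K = φ K :=
  dif_pos ⟨K.convex, K.isCompact, K.nonempty⟩

lemma bodyValue_eq {n : ℕ} (φ : ConvexBody (Euc n) → ℂ) {S : Set (Euc n)} {K : ConvexBody (Euc n)}
    (h : (K : Set (Euc n)) = S) : bodyValue φ S = φ K := by
  rw [← h, bodyValue_coe]

lemma bodyValue_empty {n : ℕ} (φ : ConvexBody (Euc n) → ℂ) : bodyValue φ ∅ = 0 :=
  dif_neg fun h => Set.not_nonempty_empty h.2.2

lemma exists_convexCombination_eq {E : Type*} [AddCommGroup E] [Module ℝ E]
    (f : E →ₗ[ℝ] ℝ) {c : ℝ} {x y : E} (hx : f x ≤ c) (hy : c ≤ f y) :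
    ∃ a b : ℝ, 0 ≤ a ∧ 0 ≤ b ∧ a + b = 1 ∧ f (a • x + b • y) = c := by
  rcases hx.eq_or_lt with h | h
  · exact ⟨1, 0, by simp, by simp, by simp, by simpa using h⟩
  · have hpos : 0 < f y - f x := by linarith
    refine ⟨(f y - c) / (f y - f x), (c - f x) / (f y - f x), div_nonneg (by linarith) hpos.le,
      div_nonneg (by linarith) hpos.le, ?_, ?_⟩
    · rw [← add_div, div_eq_one_iff_eq hpos.ne']; ring
    · simp only [map_add, map_smul, smul_eq_mul]
      field_simp
      ring

lemma IsValuation.isCutAdditive {E : Type*} [AddCommGroup E] [Module ℝ E] [TopologicalSpace E]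
    {n : ℕ} {φ : ConvexBody (Euc n) → ℂ} (hval : IsValuation φ) (A : ConvexBody (Euc n))
    (π : E →L[ℝ] Euc n) :
    IsCutAdditive fun L : Set E => bodyValue φ (A + π '' L) where
  empty := by simp [bodyValue_empty]
  cut f c L hL hLc := by
    have hcut : ∀ l ∈ L, ∀ l' ∈ L, f l ≤ c → c ≤ f l' → ∃ a b : ℝ, 0 ≤ a ∧ 0 ≤ b ∧ a + b = 1 ∧
        a • l + b • l' ∈ L ∩ {x | f x = c} := by
      intro l hl l' hl' h h'
      obtain ⟨a, b, ha, hb, hab, hc⟩ := exists_convexCombination_eq (f : E →ₗ[ℝ] ℝ) h h'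
      exact ⟨a, b, ha, hb, hab, hL hl hl' ha hb hab, hc⟩
    rcases (L ∩ {x | f x ≤ c}).eq_empty_or_nonempty with h₁ | h₁
    · have h₂ : L ∩ {x | f x = c} = ∅ := Set.eq_empty_of_subset_empty
        (h₁ ▸ Set.inter_subset_inter_right _ fun x hx => le_of_eq hx)
      have h₃ : L ∩ {x | c ≤ f x} = L := Set.inter_eq_left.2 fun x hx => by
        by_contra h
        exact h₁.le ⟨hx, (not_le.1 (show ¬ c ≤ f x from h)).le⟩
      simp only [h₁, h₂, h₃]
      ring
    rcases (L ∩ {x | c ≤ f x}).eq_empty_or_nonempty with h₂ | h₂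
    · have h₃ : L ∩ {x | f x = c} = ∅ := Set.eq_empty_of_subset_empty
        (h₂ ▸ Set.inter_subset_inter_right _ fun x hx => ge_of_eq hx)
      have h₄ : L ∩ {x | f x ≤ c} = L := Set.inter_eq_left.2 fun x hx => by
        by_contra h
        exact h₂.le ⟨hx, (not_le.1 (show ¬ f x ≤ c from h)).le⟩
      simp only [h₂, h₃, h₄]
    have h₃ : (L ∩ {x | f x = c}).Nonempty := by
      obtain ⟨l, hl, h⟩ := h₁
      obtain ⟨l', hl', h'⟩ := h₂
      obtain ⟨a, b, -, -, -, hm⟩ := hcut l hl l' hl' h h'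
      exact ⟨_, hm⟩
    let body : ∀ S : Set E, Convex ℝ S → IsCompact S → S.Nonempty → ConvexBody (Euc n) :=
      fun S h h' h'' => A + ⟨π '' S, h.linear_image (π : E →ₗ[ℝ] Euc n), h'.image π.continuous,
        h''.image _⟩
    have hbody : ∀ S h h' h'', bodyValue φ (A + π '' S) = φ (body S h h' h'') :=
      fun S h h' h'' => bodyValue_eq φ rfl
    have hle : Convex ℝ {x | f x ≤ c} := convex_halfSpace_le (f : E →ₗ[ℝ] ℝ).isLinear c
    have hge : Convex ℝ {x | c ≤ f x} := convex_halfSpace_ge (f : E →ₗ[ℝ] ℝ).isLinear c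
    have heq : Convex ℝ {x | f x = c} := convex_hyperplane (f : E →ₗ[ℝ] ℝ).isLinear c
    rw [hbody L hL hLc (h₁.mono Set.inter_subset_left),
      hbody _ (hL.inter heq) (hLc.inter_right (isClosed_eq f.continuous continuous_const)) h₃,
      hbody _ (hL.inter hle) (hLc.inter_right (isClosed_le f.continuous continuous_const)) h₁,
      hbody _ (hL.inter hge) (hLc.inter_right (isClosed_le continuous_const f.continuous)) h₂]
    refine hval _ _ _ _ ?_ ?_
    · change (A : Set (Euc n)) + π '' L =
        ((A : Set (Euc n)) + π '' (L ∩ {x | f x ≤ c})) ∪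
          ((A : Set (Euc n)) + π '' (L ∩ {x | c ≤ f x}))
      rw [← Set.add_union, ← Set.image_union, ← Set.inter_union_distrib_left]
      congr 2
      exact (Set.inter_eq_left.2 fun x _ => le_total (f x) c).symm
    · change (A : Set (Euc n)) + π '' (L ∩ {x | f x = c}) =
        ((A : Set (Euc n)) + π '' (L ∩ {x | f x ≤ c})) ∩
          ((A : Set (Euc n)) + π '' (L ∩ {x | c ≤ f x}))
      refine Set.Subset.antisymm (Set.subset_inter ?_ ?_) ?_
      · exact Set.add_subset_add_left (Set.image_mono
          (Set.inter_subset_inter_right _ fun x hx => le_of_eq hx))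
      · exact Set.add_subset_add_left (Set.image_mono
          (Set.inter_subset_inter_right _ fun x hx => ge_of_eq hx))
      · rintro z ⟨⟨k, hk, _, ⟨l, ⟨hl, hlc⟩, rfl⟩, hz⟩, ⟨k', hk', _, ⟨l', ⟨hl', hlc'⟩, rfl⟩, hz'⟩⟩
        obtain ⟨a, b, ha, hb, hab, hm⟩ := hcut l hl l' hl' hlc hlc'
        refine ⟨a • k + b • k', A.convex hk hk' ha hb hab, _, ⟨_, hm, rfl⟩, ?_⟩
        simp only at hz hz' ⊢
        calc a • k + b • k' + π (a • l + b • l') = a • (k + π l) + b • (k' + π l') := by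
              simp only [map_add, map_smul, smul_add]; abel
          _ = z := by rw [hz, hz', ← add_smul, hab, one_smul]

end CutAdditive

section SimplexRelation

/-- Inclusion-exclusion over the half-spaces `{1 ≤ a i}`: if the part of `L` outside the interiors
of these half-spaces is at most the point `(1, …, 1)`, the alternating sum vanishes. -/
lemma IsCutAdditive.sum_powerset_eq_zero {ι : Type*} [DecidableEq ι]
    {ψ : Set (ι → ℝ) → ℂ} (hψ : IsCutAdditive ψ)
    {S : Finset ι} (hS : S.Nonempty) {L : Set (ι → ℝ)} (hL : Convex ℝ L) (hLc : IsCompact L)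
    (hone : ∀ a ∈ L, (∀ i ∈ S, a i ≤ 1) → a = 1) :
    ∑ T ∈ S.powerset, (-1 : ℤ) ^ T.card • ψ (L ∩ {a | ∀ i ∈ T, 1 ≤ a i}) = 0 := by
  have hle : ∀ i : ι, Convex ℝ {a : ι → ℝ | a i ≤ 1} :=
    fun i => convex_halfSpace_le (LinearMap.proj (R := ℝ) (φ := fun _ : ι => ℝ) i).isLinear 1
  have hge : ∀ i : ι, Convex ℝ {a : ι → ℝ | 1 ≤ a i} :=
    fun i => convex_halfSpace_ge (LinearMap.proj (R := ℝ) (φ := fun _ : ι => ℝ) i).isLinear 1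
  have heq : ∀ i : ι, Convex ℝ {a : ι → ℝ | a i = 1} :=
    fun i => convex_hyperplane (LinearMap.proj (R := ℝ) (φ := fun _ : ι => ℝ) i).isLinear 1
  have cle : ∀ i : ι, IsClosed {a : ι → ℝ | a i ≤ 1} :=
    fun i => isClosed_le (continuous_apply i) continuous_const
  have cge : ∀ i : ι, IsClosed {a : ι → ℝ | 1 ≤ a i} :=
    fun i => isClosed_le continuous_const (continuous_apply i)
  have ceq : ∀ i : ι, IsClosed {a : ι → ℝ | a i = 1} :=
    fun i => isClosed_eq (continuous_apply i) continuous_const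
  have hcut : ∀ (i : ι) (L : Set (ι → ℝ)), Convex ℝ L → IsCompact L →
      ψ L - ψ (L ∩ {a | 1 ≤ a i}) = ψ (L ∩ {a | a i ≤ 1}) - ψ (L ∩ {a | a i = 1}) :=
    fun i L hL hLc => by
      have h := hψ.cut (ContinuousLinearMap.proj (R := ℝ) (φ := fun _ : ι => ℝ) i) 1 L hL hLc
      simp only [ContinuousLinearMap.proj_apply] at h
      linear_combination h
  induction hS using Finset.Nonempty.cons_induction generalizing L with
  | singleton i =>
    rw [show ({i} : Finset ι) = insert i ∅ from rfl, Finset.sum_powerset_insert (by simp)]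
    have h : L ∩ {a | a i ≤ 1} = L ∩ {a | a i = 1} := by
      refine Set.Subset.antisymm (fun a ha => ⟨ha.1, ?_⟩)
        (Set.inter_subset_inter_right _ fun x hx => le_of_eq hx)
      rw [hone a ha.1 (by simpa using ha.2)]
      rfl
    have := hcut i L hL hLc
    rw [h, sub_self] at this
    simpa [sub_eq_add_neg] using this
  | cons i S hi hS ih =>
    rw [Finset.cons_eq_insert, Finset.sum_powerset_insert hi, ← Finset.sum_add_distrib]
    have hterm : ∀ T ∈ S.powerset,
        (-1 : ℤ) ^ T.card • ψ (L ∩ {a | ∀ j ∈ T, 1 ≤ a j}) +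
          (-1 : ℤ) ^ (insert i T).card • ψ (L ∩ {a | ∀ j ∈ insert i T, 1 ≤ a j}) =
        (-1 : ℤ) ^ T.card • ψ (L ∩ {a | a i ≤ 1} ∩ {a | ∀ j ∈ T, 1 ≤ a j}) -
          (-1 : ℤ) ^ T.card • ψ (L ∩ {a | a i = 1} ∩ {a | ∀ j ∈ T, 1 ≤ a j}) := by
      intro T hT
      have hiT : i ∉ T := fun h => hi (Finset.mem_powerset.1 hT h)
      have hset : {a : ι → ℝ | ∀ j ∈ T, 1 ≤ a j} = ⋂ j ∈ T, {a | 1 ≤ a j} := by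
        ext; simp
      have hconv : Convex ℝ (L ∩ {a | ∀ j ∈ T, 1 ≤ a j}) :=
        hL.inter (hset ▸ convex_iInter₂ fun j _ => hge j)
      have hcomp : IsCompact (L ∩ {a | ∀ j ∈ T, 1 ≤ a j}) :=
        hLc.inter_right (hset ▸ isClosed_biInter fun j _ => cge j)
      have h := hcut i _ hconv hcomp
      have hins : L ∩ {a | ∀ j ∈ insert i T, 1 ≤ a j} =
          L ∩ {a | ∀ j ∈ T, 1 ≤ a j} ∩ {a | 1 ≤ a i} := by
        ext a
        simp only [Finset.forall_mem_insert, Set.mem_inter_iff, Set.mem_ofPred_eq]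
        tauto
      rw [hins, Finset.card_insert_of_notMem hiT, pow_succ, mul_neg_one, neg_smul, ← smul_sub,
        ← sub_eq_add_neg, ← smul_sub, h,
        Set.inter_right_comm L _ {a | a i ≤ 1}, Set.inter_right_comm L _ {a | a i = 1}]
    rw [Finset.sum_congr rfl hterm, Finset.sum_sub_distrib,
      ih (hL.inter (hle i)) (hLc.inter_right (cle i)) fun a ha h =>
        hone a ha.1 (by simpa [Finset.forall_mem_cons] using ⟨ha.2, h⟩),
      ih (hL.inter (heq i)) (hLc.inter_right (ceq i)) fun a ha h =>
        hone a ha.1 (by simpa [Finset.forall_mem_cons] using ⟨le_of_eq ha.2, h⟩), sub_self]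

end SimplexRelation

section PolytopeRelation

variable {n : ℕ}

/-- Points as convex bodies, as an additive homomorphism. -/
def ptHom (n : ℕ) : Euc n →+ ConvexBody (Euc n) where
  toFun := ptBody
  map_zero' := ConvexBody.ext rfl
  map_add' x y := ConvexBody.ext (Set.singleton_add_singleton (a := x) (b := y)).symm

lemma ptHom_apply (x : Euc n) : ptHom n x = ptBody x := rfl

lemma coe_ptBody (x : Euc n) : (ptBody x : Set (Euc n)) = {x} := rfl

/-- `φ` is polynomial of degree at most `d` along translations. -/
def IsTranslationPolynomial (d : ℕ) (φ : ConvexBody (Euc n) → ℂ) : Prop :=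
  ∀ K : ConvexBody (Euc n), ∃ p : MvPolynomial (Fin n) ℂ, p.totalDegree ≤ d ∧
    ∀ x : Euc n, φ (K + ptBody x) = MvPolynomial.eval (fun i => (x i : ℂ)) p

/-- The restriction of a polynomial to a line through the origin. -/
lemma MvPolynomial.exists_polynomial_eval_smul {σ : Type*} (p : MvPolynomial σ ℂ) (u : σ → ℂ) :
    ∃ q : Polynomial ℂ, q.natDegree ≤ p.totalDegree ∧
      (∀ j, q.coeff j = MvPolynomial.eval u (p.homogeneousComponent j)) ∧
      ∀ t : ℂ, q.eval t = MvPolynomial.eval (fun i => t * u i) p := by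
  have hcoeff : ∀ t : ℂ, MvPolynomial.eval (fun i => t * u i) p =
      ∑ j ∈ Finset.range (p.totalDegree + 1),
        MvPolynomial.eval u (p.homogeneousComponent j) * t ^ j := by
    intro t
    conv_lhs => rw [← MvPolynomial.sum_homogeneousComponent p, map_sum]
    refine Finset.sum_congr rfl fun j _ => ?_
    rw [MvPolynomial.eval_eq, MvPolynomial.eval_eq, Finset.sum_mul]
    refine Finset.sum_congr rfl fun m hm => ?_
    have hdeg := MvPolynomial.homogeneousComponent_isHomogeneous j p
      (MvPolynomial.mem_support_iff.1 hm)
    have hdeg' : ∑ i ∈ m.support, m i = j := by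
      rw [← hdeg, Finsupp.weight_apply, Finsupp.sum]
      simp
    simp only [mul_pow, Finset.prod_mul_distrib, Finset.prod_pow_eq_pow_sum, hdeg']
    ring
  refine ⟨∑ j ∈ Finset.range (p.totalDegree + 1),
    Polynomial.C (MvPolynomial.eval u (p.homogeneousComponent j)) * Polynomial.X ^ j, ?_, ?_, ?_⟩
  · refine Polynomial.natDegree_sum_le_of_forall_le _ _ fun j hj => ?_
    exact (Polynomial.natDegree_C_mul_X_pow_le _ _).trans
      (Nat.lt_succ_iff.1 (Finset.mem_range.1 hj))
  · intro j
    rw [Polynomial.finsetSum_coeff]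
    simp only [Polynomial.coeff_C_mul_X_pow]
    rw [Finset.sum_ite_eq]
    split_ifs with h
    · rfl
    · rw [MvPolynomial.homogeneousComponent_eq_zero _ _ (by simpa using h), map_zero]
  · intro t
    rw [hcoeff, Polynomial.eval_finsetSum]
    simp

lemma IsTranslationPolynomial.exists_polynomial {d : ℕ} {φ : ConvexBody (Euc n) → ℂ}
    (hφ : IsTranslationPolynomial d φ) (K : ConvexBody (Euc n)) (u : Euc n) :
    ∃ q : Polynomial ℂ, q.natDegree ≤ d ∧ ∀ t : ℝ, φ (K + ptBody (t • u)) = q.eval (t : ℂ) := by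
  obtain ⟨p, hp, hpφ⟩ := hφ K
  obtain ⟨q, hq, -, hqe⟩ := MvPolynomial.exists_polynomial_eval_smul p fun i => (u i : ℂ)
  refine ⟨q, hq.trans hp, fun t => ?_⟩
  rw [hpφ, hqe]
  simp

lemma IsTranslationPolynomial.fwdDiff_iter_eq_zero {d : ℕ} {φ : ConvexBody (Euc n) → ℂ}
    (hφ : IsTranslationPolynomial d φ) (u : Euc n) : (fwdDiff (ptBody u))^[d + 1] φ = 0 := by
  funext A
  obtain ⟨q, hq, hqe⟩ := hφ.exists_polynomial A u
  have h := congrFun (Polynomial.fwdDiff_iter_eq_zero_of_degree_lt (Nat.lt_succ_of_le hq)) 0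
  rw [fwdDiff_iter_eq_sum_shift] at h ⊢
  refine Eq.trans (Finset.sum_congr rfl fun k _ => ?_) h
  rw [← ptHom_apply, ← map_nsmul, ptHom_apply, ← Nat.cast_smul_eq_nsmul ℝ, hqe]
  simp

lemma mem_smul_stdSimplex_iff {ι : Type*} [Fintype ι] [Nonempty ι] {k : ℝ} (hk : 0 ≤ k)
    {a : ι → ℝ} : a ∈ k • stdSimplex ℝ ι ↔ (∀ i, 0 ≤ a i) ∧ ∑ i, a i = k := by
  constructor
  · rintro ⟨w, ⟨hw, hw1⟩, rfl⟩
    exact ⟨fun i => mul_nonneg hk (hw i), by simp [← Finset.mul_sum, hw1]⟩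
  · rintro ⟨ha, hsum⟩
    rcases hk.eq_or_lt with rfl | hk
    · have h0 : a = 0 := funext fun i =>
        (Finset.sum_eq_zero_iff_of_nonneg fun i _ => ha i).1 hsum i (Finset.mem_univ i)
      classical
      exact ⟨_, single_mem_stdSimplex ℝ (Classical.arbitrary ι), by simp [h0]⟩
    · refine ⟨k⁻¹ • a, ⟨fun i => mul_nonneg (inv_nonneg.2 hk.le) (ha i), ?_⟩, ?_⟩
      · simp [← Finset.mul_sum, hsum, hk.ne']
      · simp [smul_smul, hk.ne']

/-- In the polytope algebra, the product of the differences between a polytope and its vertices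
vanishes. -/
lemma IsValuation.sum_polytope_eq_zero {φ : ConvexBody (Euc n) → ℂ} (hval : IsValuation φ)
    {m : ℕ} (v : Fin m → Euc n) (P : ConvexBody (Euc n))
    (hP : (P : Set (Euc n)) = convexHull ℝ (Set.range v)) (A : ConvexBody (Euc n)) :
    ∑ T : Finset (Fin m),
      (-1 : ℤ) ^ T.card • φ (A + ((m - T.card) • P + ∑ i ∈ T, ptBody (v i))) = 0 := by
  have hm : Nonempty (Fin m) := by
    by_contra h
    rw [not_nonempty_iff] at h
    have := P.nonempty
    rw [hP, convexHull_nonempty_iff] at this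
    obtain ⟨_, i, _⟩ := this
    exact h.elim i
  let π : (Fin m → ℝ) →L[ℝ] Euc n :=
    ∑ i, (ContinuousLinearMap.proj (R := ℝ) (φ := fun _ : Fin m => ℝ) i).smulRight (v i)
  have hπ : ∀ a, π a = ∑ i, a i • v i := fun a => by simp [π]
  have hPim : (P : Set (Euc n)) = π '' stdSimplex ℝ (Fin m) := by
    rw [hP, ← convexHull_rangle_single_eq_stdSimplex]
    have := (π : (Fin m → ℝ) →ₗ[ℝ] Euc n).image_convexHull (Set.range fun i => Pi.single i (1 : ℝ))
    refine Eq.trans ?_ this.symm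
    rw [← Set.range_comp]
    congr 2
    funext i
    simp [hπ, Pi.single_apply]
  set L : Set (Fin m → ℝ) := (m : ℝ) • stdSimplex ℝ (Fin m) with hLdef
  have hmem : ∀ a, a ∈ L ↔ (∀ i, 0 ≤ a i) ∧ ∑ i, a i = m := fun a =>
    mem_smul_stdSimplex_iff (Nat.cast_nonneg m)
  have hcut := (hval.isCutAdditive A π).sum_powerset_eq_zero (L := L) Finset.univ_nonempty
    ((convex_stdSimplex ℝ _).smul _) ((isCompact_stdSimplex ℝ _).smul _) (by
      intro a ha hle
      rw [hmem] at ha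
      have h1 : ∑ i, (1 - a i) = 0 := by simp [ha.2]
      rw [Finset.sum_eq_zero_iff_of_nonneg fun i hi => by linarith [hle i hi]] at h1
      funext i
      have := h1 i (Finset.mem_univ i)
      simp only [Pi.one_apply]
      linarith)
  rw [Finset.powerset_univ] at hcut
  refine Eq.trans (Finset.sum_congr rfl fun T _ => ?_) hcut
  congr 1
  refine (bodyValue_eq φ ?_).symm
  have hT : T.card ≤ m := by simpa using Finset.card_le_univ T
  rw [← ConvexBody.natCast_smul]
  simp only [← ptHom_apply, ← map_sum]
  simp only [ConvexBody.coe_add, ConvexBody.coe_smul, ptHom_apply, coe_ptBody]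
  congr 1
  rw [hPim, Set.add_singleton]
  set e : Fin m → ℝ := fun i => if i ∈ T then 1 else 0 with he
  have hesum : ∑ i, e i = T.card := by simp [he]
  have hπe : π e = ∑ i ∈ T, v i := by simp [hπ, he, ite_smul]
  rw [← hπe, show (((m - T.card : ℕ) : ℝ) • π '' stdSimplex ℝ (Fin m)) =
    π '' (((m - T.card : ℕ) : ℝ) • stdSimplex ℝ (Fin m)) from (Set.image_smul_comm _ _ _
      fun b => map_smul π _ b).symm, Set.image_image]
  have hmem' : ∀ b, b ∈ ((m - T.card : ℕ) : ℝ) • stdSimplex ℝ (Fin m) ↔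
      (∀ i, 0 ≤ b i) ∧ ∑ i, b i = m - T.card := fun b => by
    rw [mem_smul_stdSimplex_iff (Nat.cast_nonneg _), Nat.cast_sub hT]
  ext z
  constructor
  · rintro ⟨b, hb, rfl⟩
    obtain ⟨hb, hbs⟩ := (hmem' b).1 hb
    refine ⟨b + e, ⟨(hmem _).2 ⟨fun i => ?_, ?_⟩, fun i hi => ?_⟩, map_add π b e⟩
    · have : 0 ≤ e i := by simp only [he]; split_ifs <;> norm_num
      exact add_nonneg (hb i) this
    · simp [Finset.sum_add_distrib, hesum, hbs]
    · simpa [he, hi] using hb i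
  · rintro ⟨a, ⟨haL, haT⟩, rfl⟩
    obtain ⟨ha, has⟩ := (hmem a).1 haL
    refine ⟨a - e, (hmem' _).2 ⟨fun i => ?_, ?_⟩, by simp⟩
    · by_cases hi : i ∈ T
      · simpa [he, hi] using haT i hi
      · simpa [he, hi] using ha i
    · simp [Finset.sum_sub_distrib, hesum, has]

lemma IsValuation.exists_fwdDiff_iter_polytope_eq_zero {d : ℕ} {φ : ConvexBody (Euc n) → ℂ}
    (hval : IsValuation φ) (hφ : IsTranslationPolynomial d φ)
    {m : ℕ} (v : Fin m → Euc n) (P : ConvexBody (Euc n))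
    (hP : (P : Set (Euc n)) = convexHull ℝ (Set.range v)) : ∃ N, (fwdDiff P)^[N] φ = 0 :=
  exists_fwdDiff_iter_eq_zero φ P (fun i => ptBody (v i)) (hval.sum_polytope_eq_zero v P hP)
    fun i => hφ.fwdDiff_iter_eq_zero (v i)

end PolytopeRelation

section Growth

variable {n : ℕ}

lemma IsCutAdditive.norm_le_of_slabs {E : Type*} [AddCommGroup E] [Module ℝ E] [TopologicalSpace E]
    {ψ : Set E → ℂ} (hψ : IsCutAdditive ψ) (f : E →L[ℝ] ℝ) {M : ℝ} {c : ℝ} (N : ℕ) {L : Set E}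
    (hL : Convex ℝ L) (hLc : IsCompact L)
    (hM : ∀ L' ⊆ L, Convex ℝ L' → IsCompact L' → (∃ c, ∀ x ∈ L', c ≤ f x ∧ f x ≤ c + 1) →
      ‖ψ L'‖ ≤ M)
    (hN : ∀ x ∈ L, c ≤ f x ∧ f x ≤ c + N) : ‖ψ L‖ ≤ (2 * N + 1) * M := by
  induction N generalizing L with
  | zero =>
    simpa using hM L subset_rfl hL hLc ⟨c, fun x hx => by
      have := hN x hx
      simp only [Nat.cast_zero, add_zero] at this
      exact ⟨this.1, by linarith⟩⟩
  | succ N ih =>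
    have hle : Convex ℝ {x | f x ≤ c + N} := convex_halfSpace_le f.toLinearMap.isLinear _
    have hge : Convex ℝ {x | c + N ≤ f x} := convex_halfSpace_ge f.toLinearMap.isLinear _
    have heq : Convex ℝ {x | f x = c + N} := convex_hyperplane f.toLinearMap.isLinear _
    have cle := hLc.inter_right (isClosed_le f.continuous (continuous_const (y := c + (N : ℝ))))
    have cge := hLc.inter_right (isClosed_le (continuous_const (y := c + (N : ℝ))) f.continuous)
    have ceq := hLc.inter_right (isClosed_eq f.continuous (continuous_const (y := c + (N : ℝ))))
    have h1 := ih (hL.inter hle) cle (fun L' hL' => hM L' (hL'.trans inter_subset_left))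
      fun x hx => ⟨(hN x hx.1).1, hx.2⟩
    have h2 := hM _ inter_subset_left (hL.inter hge) cge ⟨c + N, fun x hx => ⟨hx.2, by
      have := (hN x hx.1).2
      push_cast at this
      linarith⟩⟩
    have h3 := hM _ inter_subset_left (hL.inter heq) ceq ⟨c + N, fun x hx =>
      ⟨ge_of_eq hx.2, by have : f x = c + N := hx.2; linarith⟩⟩
    rw [eq_sub_of_add_eq (hψ.cut f (c + N) L hL hLc)]
    refine (norm_sub_le _ _).trans ((add_le_add_left (norm_add_le _ _) _).trans ?_)
    push_cast
    linarith

lemma IsCutAdditive.norm_le_of_unit_boxes {ψ : Set (Euc n) → ℂ} (hψ : IsCutAdditive ψ) {M : ℝ}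
    {R : ℕ} (U : Finset (Fin n)) {L : Set (Euc n)} (hL : Convex ℝ L) (hLc : IsCompact L)
    (hbox : ∀ x ∈ L, ∀ i, |x i| ≤ R) (hU : ∀ i ∉ U, ∃ c, ∀ x ∈ L, c ≤ x i ∧ x i ≤ c + 1)
    (hM : ∀ L' ⊆ L, Convex ℝ L' → IsCompact L' → (∀ i, ∃ c, ∀ x ∈ L', c ≤ x i ∧ x i ≤ c + 1) →
      ‖ψ L'‖ ≤ M) : ‖ψ L‖ ≤ (4 * R + 1) ^ U.card * M := by
  induction U using Finset.induction_on generalizing L with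
  | empty => simpa using hM L subset_rfl hL hLc fun i => hU i (Finset.notMem_empty i)
  | insert j U hj ih =>
    have h := hψ.norm_le_of_slabs (EuclideanSpace.proj j) (M := (4 * R + 1) ^ U.card * M)
      (c := -R) (2 * R) hL hLc (fun L' hL' hconv hcomp hslab => ?_) fun x hx => ?_
    · rw [Finset.card_insert_of_notMem hj, pow_succ]
      refine h.trans (le_of_eq ?_)
      push_cast
      ring
    · refine ih hconv hcomp (fun x hx => hbox x (hL' hx)) (fun i hi => ?_)
        fun L'' hL'' => hM L'' (hL''.trans hL')
      rcases eq_or_ne i j with rfl | hij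
      · exact hslab
      · obtain ⟨c, hc⟩ := hU i (by simp [hij, hi])
        exact ⟨c, fun x hx => hc x (hL' hx)⟩
    · have := abs_le.1 (hbox x hx j)
      simp only [PiLp.proj_apply]
      push_cast
      exact ⟨this.1, by linarith [this.2]⟩

lemma norm_le_card_mul_of_forall_abs_le {x : Euc n} {r : ℝ} (h : ∀ i, |x i| ≤ r) :
    ‖x‖ ≤ n * r := by
  have hx : x = ∑ i, EuclideanSpace.single i (x i) := by
    ext j
    simp [Pi.single_apply]
  rw [hx]
  refine (norm_sum_le_of_le _ (fun i _ => ?_) : _ ≤ ∑ _i : Fin n, r).trans (by simp)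
  simpa using h i

lemma IsTranslationPolynomial.exists_norm_le_of_unit_box {d : ℕ} {φ : ConvexBody (Euc n) → ℂ}
    (hφ : IsTranslationPolynomial d φ) (hcont : Continuous φ) :
    ∃ C : ℝ, 0 ≤ C ∧ ∀ R : ℕ, 1 ≤ R → ∀ L : ConvexBody (Euc n), (∀ x ∈ L, ∀ i, |x i| ≤ R) →
      (∀ i, ∃ c, ∀ x ∈ L, c ≤ x i ∧ x i ≤ c + 1) → ‖φ L‖ ≤ C * R ^ d := by
  obtain ⟨M, hM⟩ := ((ConvexBody.isCompact_setOf_subset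
    (isCompact_closedBall (0 : Euc n) (n + d * n))).image hcont).isBounded.exists_norm_le
  have hM' : ∀ K : ConvexBody (Euc n), (∀ x ∈ K, ‖x‖ ≤ n + d * n) → ‖φ K‖ ≤ M := fun K hK =>
    hM _ (mem_image_of_mem _ fun x hx => by simpa using hK x hx)
  have hM0 : 0 ≤ M := (norm_nonneg _).trans (hM' (ptBody 0) fun x hx => by
    have : x = 0 := hx
    rw [this, norm_zero]
    positivity)
  refine ⟨(d + 1) * (2 ^ d * M), by positivity, fun R hR L hbox hunit => ?_⟩
  have hR0 : (0 : ℝ) < R := by exact_mod_cast hR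
  obtain ⟨x, hx⟩ := L.nonempty
  set u : Euc n := (R : ℝ)⁻¹ • x with hu
  set L0 := L + ptBody (-x) with hL0
  have hunorm : ‖u‖ ≤ n := by
    simpa using norm_le_card_mul_of_forall_abs_le (x := u) (r := 1) fun i => by
      rw [hu, PiLp.smul_apply, smul_eq_mul, abs_mul, abs_of_pos (inv_pos.2 hR0),
        inv_mul_le_one₀ hR0]
      exact hbox x hx i
  have hLeq : L0 + R • ptBody u = L := by
    rw [hL0, ← ptHom_apply, ← ptHom_apply, ← map_nsmul, add_assoc, ← map_add,
      ← Nat.cast_smul_eq_nsmul ℝ, hu, smul_smul, mul_inv_cancel₀ hR0.ne', one_smul,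
      neg_add_cancel, map_zero, add_zero]
  have hbound : ∀ k ≤ d, ‖φ (L0 + k • ptBody u)‖ ≤ M := fun k hk => by
    refine hM' _ fun z hz => ?_
    rw [hL0, ← ptHom_apply, ← ptHom_apply, ← map_nsmul, ptHom_apply, ptHom_apply] at hz
    obtain ⟨_, ⟨y, hy, _, rfl, rfl⟩, _, rfl, rfl⟩ := hz
    refine (norm_add_le _ _).trans (add_le_add ?_ ?_)
    · simpa using norm_le_card_mul_of_forall_abs_le (x := y + -x) (r := 1) fun i => by
        obtain ⟨c, hc⟩ := hunit i
        have h1 := hc x hx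
        have h2 := hc y hy
        rw [PiLp.add_apply, PiLp.neg_apply, abs_le]
        constructor <;> linarith
    · rw [← Nat.cast_smul_eq_nsmul ℝ, norm_smul, Real.norm_natCast]
      gcongr
  have hterm : ∀ k, ‖R.choose k • (fwdDiff (ptBody u))^[k] φ L0‖ ≤
      if k ≤ d then (R : ℝ) ^ d * (2 ^ d * M) else 0 := fun k => by
    split_ifs with hk
    · rw [← Nat.cast_smul_eq_nsmul ℝ, norm_smul, Real.norm_natCast]
      refine mul_le_mul ?_ ?_ (norm_nonneg _) (by positivity)
      · refine le_trans (b := (R : ℝ) ^ k) ?_ (pow_le_pow_right₀ (by exact_mod_cast hR) hk)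
        exact_mod_cast Nat.choose_le_pow R k
      · refine (norm_fwdDiff_iter_le φ (ptBody u) L0 k
          fun j hj => hbound j (hj.trans hk)).trans ?_
        gcongr
        norm_num
    · rw [fwdDiff_iter_eq_zero_mono (by omega) (hφ.fwdDiff_iter_eq_zero u)]
      simp
  rw [← hLeq, shift_eq_sum_fwdDiff_iter (ptBody u) φ]
  refine (norm_sum_le_of_le _ fun k _ => hterm k).trans ?_
  rw [← Finset.sum_filter, Finset.sum_const, nsmul_eq_mul]
  have hcard : (((Finset.range (R + 1)).filter (· ≤ d)).card : ℝ) ≤ d + 1 := by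
    have : (Finset.range (R + 1)).filter (· ≤ d) ⊆ Finset.range (d + 1) := fun k hk => by
      simp only [Finset.mem_filter, Finset.mem_range] at hk ⊢
      omega
    exact_mod_cast (Finset.card_le_card this).trans (Finset.card_range _).le
  calc _ ≤ ((d : ℝ) + 1) * ((R : ℝ) ^ d * (2 ^ d * M)) := by gcongr
    _ = _ := by ring

lemma IsValuation.exists_norm_le_of_box {d : ℕ} {φ : ConvexBody (Euc n) → ℂ}
    (hval : IsValuation φ) (hφ : IsTranslationPolynomial d φ) (hcont : Continuous φ) :
    ∃ C : ℝ, 0 ≤ C ∧ ∀ R : ℕ, 1 ≤ R → ∀ L : ConvexBody (Euc n), (∀ x ∈ L, ∀ i, |x i| ≤ R) →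
      ‖φ L‖ ≤ C * R ^ (d + n) := by
  obtain ⟨C, hC0, hC⟩ := hφ.exists_norm_le_of_unit_box hcont
  refine ⟨5 ^ n * C, by positivity, fun R hR L hbox => ?_⟩
  have hR1 : (1 : ℝ) ≤ R := by exact_mod_cast hR
  have hcut := hval.isCutAdditive 0 (ContinuousLinearMap.id ℝ (Euc n))
  have h := hcut.norm_le_of_unit_boxes (M := C * R ^ d) Finset.univ L.convex L.isCompact hbox
    (by simp) fun L' hL' hconv hcomp hunit => by
      rcases L'.eq_empty_or_nonempty with rfl | hne
      · rw [hcut.empty, norm_zero]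
        positivity
      · simp only [ConvexBody.coe_zero, zero_add, ContinuousLinearMap.coe_id', image_id]
        rw [bodyValue_eq φ (S := L') (K := ⟨L', hconv, hcomp, hne⟩) rfl]
        exact hC R hR _ (fun x hx => hbox x (hL' hx)) hunit
  simp only [ConvexBody.coe_zero, zero_add, ContinuousLinearMap.coe_id', image_id, bodyValue_coe,
    Finset.card_univ, Fintype.card_fin] at h
  refine h.trans ?_
  calc (4 * (R : ℝ) + 1) ^ n * (C * R ^ d) ≤ (5 * R) ^ n * (C * R ^ d) := by
        gcongr
        linarith
    _ = _ := by ring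

lemma IsValuation.exists_norm_add_nsmul_le {d : ℕ} {φ : ConvexBody (Euc n) → ℂ}
    (hval : IsValuation φ) (hφ : IsTranslationPolynomial d φ) (hcont : Continuous φ)
    (A P : ConvexBody (Euc n)) :
    ∃ C : ℝ, ∀ k : ℕ, ‖φ (A + k • P)‖ ≤ C * (k + 1) ^ (d + n) := by
  obtain ⟨C, -, hC⟩ := hval.exists_norm_le_of_box hφ hcont
  obtain ⟨b, hb⟩ := (A.isCompact.union P.isCompact).isBounded.exists_norm_le
  obtain ⟨r, hr⟩ := exists_nat_ge (max b 1)
  have hr1 : 1 ≤ r := by exact_mod_cast (le_max_right _ _).trans hr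
  have hr' : ∀ x, x ∈ A ∨ x ∈ P → ‖x‖ ≤ r := fun x hx =>
    (hb x hx).trans ((le_max_left _ _).trans hr)
  refine ⟨C * r ^ (d + n), fun k => ?_⟩
  refine (hC (r * (k + 1)) (Nat.mul_pos hr1 k.succ_pos) _ fun x hx i => ?_).trans (le_of_eq ?_)
  · rw [← ConvexBody.natCast_smul] at hx
    obtain ⟨y, hy, _, ⟨z, hz, rfl⟩, rfl⟩ := hx
    rw [← Real.norm_eq_abs]
    refine (PiLp.norm_apply_le _ i).trans ((norm_add_le _ _).trans ?_)
    have h1 := hr' y (Or.inl hy)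
    have h2 : ‖(k : ℝ) • z‖ ≤ k * r := by
      rw [norm_smul, Real.norm_natCast]
      gcongr
      exact hr' z (Or.inr hz)
    push_cast
    linarith
  · push_cast
    rw [mul_pow]
    ring

end Growth

lemma exists_polynomial_of_fwdDiff_iter_eq_zero {M : Type*} [AddCommMonoid M] {f : M → ℂ} {P : M}
    {D : ℕ} (hf : (fwdDiff P)^[D + 1] f = 0) (A : M) :
    ∃ q : Polynomial ℂ, q.natDegree ≤ D ∧ ∀ k : ℕ, f (A + k • P) = q.eval (k : ℂ) := by
  refine ⟨∑ j ∈ Finset.range (D + 1),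
    Polynomial.C ((fwdDiff P)^[j] f A / (j.factorial : ℂ)) * descPochhammer ℂ j, ?_, fun k => ?_⟩
  · refine Polynomial.natDegree_sum_le_of_forall_le _ _ fun j hj => ?_
    refine (Polynomial.natDegree_C_mul_le _ _).trans ?_
    rw [descPochhammer_natDegree]
    exact Nat.lt_succ_iff.1 (Finset.mem_range.1 hj)
  · have hterm : ∀ j, k.choose j • (fwdDiff P)^[j] f A =
        (Polynomial.C ((fwdDiff P)^[j] f A / (j.factorial : ℂ)) * descPochhammer ℂ j).eval
          (k : ℂ) := fun j => by
      have : (j.factorial : ℂ) ≠ 0 := by exact_mod_cast j.factorial_ne_zero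
      rw [Polynomial.eval_mul, Polynomial.eval_C, descPochhammer_eval_eq_descFactorial,
        Nat.descFactorial_eq_factorial_mul_choose, nsmul_eq_mul]
      push_cast
      field_simp
    rw [shift_eq_sum_fwdDiff_iter P f, Polynomial.eval_finsetSum,
      ← Finset.sum_congr rfl fun j _ => hterm j]
    trans ∑ j ∈ Finset.range (D + k + 1), k.choose j • (fwdDiff P)^[j] f A
    · refine Finset.sum_subset (Finset.range_mono (by omega)) fun j _ hj => ?_
      rw [Nat.choose_eq_zero_of_lt (by simpa using hj), zero_smul]
    · refine (Finset.sum_subset (Finset.range_mono (by omega)) fun j _ hj => ?_).symm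
      rw [fwdDiff_iter_eq_zero_mono (by simpa using hj) hf, Pi.zero_apply, smul_zero]

section MinkowskiSegment

variable {n : ℕ} {d : ℕ} {φ : ConvexBody (Euc n) → ℂ}

lemma IsValuation.fwdDiff_iter_eq_zero (hval : IsValuation φ) (hφ : IsTranslationPolynomial d φ)
    (hcont : Continuous φ) (B : ConvexBody (Euc n)) : (fwdDiff B)^[d + n + 1] φ = 0 := by
  funext A
  have hclosed : IsClosed {B : ConvexBody (Euc n) | (fwdDiff B)^[d + n + 1] φ A = 0} := by
    simp only [fwdDiff_iter_eq_sum_shift]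
    refine isClosed_eq (continuous_finsetSum _ fun k _ => ?_) continuous_const
    exact (hcont.comp (continuous_const.add (continuous_nsmul k))).const_smul _
  refine hclosed.closure_subset_iff.2 subset_rfl (Metric.mem_closure_iff.2 fun ε hε => ?_)
  obtain ⟨m, v, P, hP, hdist⟩ := ConvexBody.exists_polytope_dist_le B (half_pos hε)
  obtain ⟨N, hN⟩ := hval.exists_fwdDiff_iter_polytope_eq_zero hφ v P hP
  refine ⟨P, congrFun (fwdDiff_iter_eq_zero_of_growth hN fun A =>
    hval.exists_norm_add_nsmul_le hφ hcont A P) A, ?_⟩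
  rw [dist_comm]
  linarith

lemma IsValuation.exists_polynomial_add_smul (hval : IsValuation φ)
    (hφ : IsTranslationPolynomial d φ) (hcont : Continuous φ) (A B : ConvexBody (Euc n)) :
    ∃ q : Polynomial ℂ, q.natDegree ≤ d + n ∧
      ∀ t : ℝ, 0 ≤ t → φ (A + t • B) = q.eval (t : ℂ) := by
  obtain ⟨q, hq, hqe⟩ := exists_polynomial_of_fwdDiff_iter_eq_zero
    (hval.fwdDiff_iter_eq_zero hφ hcont B) A
  refine ⟨q, hq, fun t ht => ?_⟩
  have hfrac : ∀ k m : ℕ, 0 < m → φ (A + ((k : ℝ) / m) • B) = q.eval ((k : ℂ) / m) := by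
    intro k m hm
    have hm0 : (m : ℝ) ≠ 0 := by exact_mod_cast hm.ne'
    have hm0' : (m : ℂ) ≠ 0 := by exact_mod_cast hm.ne'
    obtain ⟨r, -, hr⟩ := exists_polynomial_of_fwdDiff_iter_eq_zero
      (hval.fwdDiff_iter_eq_zero hφ hcont ((m : ℝ)⁻¹ • B)) A
    have hr' : ∀ k : ℕ, φ (A + ((k : ℝ) / m) • B) = r.eval (k : ℂ) := fun k => by
      rw [← hr, ← ConvexBody.natCast_smul, smul_smul, div_eq_mul_inv]
    have heq : r.comp (Polynomial.C (m : ℂ) * Polynomial.X) = q := by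
      refine Polynomial.eq_of_infinite_eval_eq _ _
        ((Set.infinite_range_of_injective (Nat.cast_injective (R := ℂ))).mono ?_)
      rintro _ ⟨j, rfl⟩
      have h1 := hr' (m * j)
      rw [Nat.cast_mul, mul_div_cancel_left₀ _ hm0, ConvexBody.natCast_smul, hqe] at h1
      simp [h1]
    rw [hr', ← heq]
    simp [mul_div_cancel₀ _ hm0']
  have hcongr := (Rat.denseRange_cast (𝕜 := ℝ)).equalizer
    (g := fun t : ℝ => φ (A + |t| • B)) (h := fun t : ℝ => q.eval ((|t| : ℝ) : ℂ))
    (hcont.comp (continuous_const.add ((ConvexBody.continuous_smul_left B).comp continuous_abs)))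
    (q.continuous.comp (Complex.continuous_ofReal.comp continuous_abs)) (by
      funext x
      have hx : |((x : ℚ) : ℝ)| = (x.num.natAbs : ℝ) / (x.den : ℝ) := by
        rw [Rat.cast_def, abs_div, Nat.abs_cast, Nat.cast_natAbs, Int.cast_abs]
      simp only [Function.comp_apply, hx]
      rw [hfrac _ _ x.den_pos]
      push_cast
      rfl)
  simpa [abs_of_nonneg ht] using congrFun hcongr t

end MinkowskiSegment

/-- A function on the orthant that is polynomial of bounded degree in each variable separately is
polynomial. -/
lemma exists_mvPolynomial_of_separately {D : ℕ} (s : ℕ) (F : (Fin s → ℝ) → ℂ)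
    (hF : ∀ lam : Fin s → ℝ, (∀ i, 0 ≤ lam i) → ∀ i, ∃ q : Polynomial ℂ, q.natDegree ≤ D ∧
      ∀ t : ℝ, 0 ≤ t → F (Function.update lam i t) = q.eval (t : ℂ)) :
    ∃ p : MvPolynomial (Fin s) ℂ, ∀ lam : Fin s → ℝ, (∀ i, 0 ≤ lam i) →
      F lam = MvPolynomial.eval (fun i => (lam i : ℂ)) p := by
  induction s with
  | zero => exact ⟨MvPolynomial.C (F 0), fun lam _ => by simp [Subsingleton.elim lam 0]⟩
  | succ s ih =>
    have hslice : ∀ k : ℕ, ∃ p : MvPolynomial (Fin s) ℂ, ∀ mu : Fin s → ℝ, (∀ i, 0 ≤ mu i) →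
        F (Fin.cons (k : ℝ) mu) = MvPolynomial.eval (fun i => (mu i : ℂ)) p := fun k => by
      refine ih (fun mu => F (Fin.cons (k : ℝ) mu)) fun mu hmu i => ?_
      obtain ⟨q, hq, hqe⟩ := hF (Fin.cons (k : ℝ) mu)
        (Fin.cases (by simp) (by simpa using hmu)) i.succ
      refine ⟨q, hq, fun t ht => ?_⟩
      rw [Fin.cons_update]
      exact hqe t ht
    choose p hp using hslice
    set nodes : ℕ → ℂ := fun k => (k : ℂ) with hnodes
    refine ⟨∑ k ∈ Finset.range (D + 1), MvPolynomial.rename Fin.succ (p k) *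
      Polynomial.aeval (MvPolynomial.X 0) (Lagrange.basis (Finset.range (D + 1)) nodes k),
      fun lam hlam => ?_⟩
    obtain ⟨q, hq, hqe⟩ := hF lam hlam 0
    have hq' : q = Lagrange.interpolate (Finset.range (D + 1)) nodes fun k => q.eval (nodes k) := by
      refine Lagrange.eq_interpolate (fun a _ b _ h => Nat.cast_injective h) ?_
      rw [Finset.card_range]
      exact (Polynomial.degree_le_natDegree.trans (Nat.cast_le.2 hq)).trans_lt
        (by exact_mod_cast Nat.lt_succ_self D)
    have h0 := hqe (lam 0) (hlam 0)
    rw [Function.update_eq_self] at h0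
    rw [h0, hq', Lagrange.interpolate_apply, Polynomial.eval_finsetSum, map_sum]
    refine Finset.sum_congr rfl fun k _ => ?_
    have hk : q.eval (nodes k) = MvPolynomial.eval (fun i => (lam (Fin.succ i) : ℂ)) (p k) := by
      have h1 := hqe k (Nat.cast_nonneg k)
      rw [← hp k (fun i => lam i.succ) fun i => hlam _]
      rw [Complex.ofReal_natCast] at h1
      rw [hnodes, ← h1]
      congr 1
      funext i
      refine Fin.cases ?_ (fun i => ?_) i <;> simp
    rw [Polynomial.eval_mul, Polynomial.eval_C, hk, map_mul, MvPolynomial.eval_rename,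
      Polynomial.aeval_def, Polynomial.hom_eval₂]
    congr 1
    rw [Polynomial.eval, MvPolynomial.eval_X]
    congr 1
    ext
    simp

/-- A polynomial whose restrictions to all lines through the origin in directions of the integer
orthant have degree at most `D` has total degree at most `D`. -/
lemma MvPolynomial.totalDegree_le_of_restrict {s D : ℕ} (p : MvPolynomial (Fin s) ℂ)
    (hp : ∀ h : Fin s → ℕ, ∃ q : Polynomial ℂ, q.natDegree ≤ D ∧
      ∀ t : ℕ, MvPolynomial.eval (fun i => (t : ℂ) * (h i : ℂ)) p = q.eval (t : ℂ)) :
    p.totalDegree ≤ D := by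
  have hzero : ∀ j, D < j → p.homogeneousComponent j = 0 := fun j hj => by
    refine MvPolynomial.funext_set (fun _ => Set.range ((↑) : ℕ → ℂ))
      (fun _ => Set.infinite_range_of_injective Nat.cast_injective) fun x hx => ?_
    choose h hh using fun i => hx i (Set.mem_univ i)
    obtain rfl : (fun i => (h i : ℂ)) = x := _root_.funext hh
    obtain ⟨q, hq, hqe⟩ := hp h
    obtain ⟨r, -, hrc, hre⟩ := MvPolynomial.exists_polynomial_eval_smul p fun i => (h i : ℂ)
    have heq : r = q := by
      refine Polynomial.eq_of_infinite_eval_eq _ _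
        ((Set.infinite_range_of_injective (Nat.cast_injective (R := ℂ))).mono ?_)
      rintro _ ⟨t, rfl⟩
      exact (hre t).trans (hqe t)
    rw [← hrc, heq, map_zero, Polynomial.coeff_eq_zero_of_natDegree_lt (hq.trans_lt hj)]
  refine Finset.sup_le fun m hm => ?_
  by_contra! hlt
  have hcoeff := congrArg (MvPolynomial.coeff m) (hzero m.degree hlt)
  rw [MvPolynomial.coeff_homogeneousComponent, if_pos rfl, MvPolynomial.coeff_zero] at hcoeff
  exact MvPolynomial.mem_support_iff.1 hm hcoeff

/-- (Khovanskii–Pukhlikov) If `φ` is a continuous valuation which is polynomial of degree at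
most `d` (i.e. `x ↦ φ(K + x)` is a polynomial of total degree `≤ d` for every `K`), then for
all convex bodies `K₁, …, K_s` the function `λ ↦ φ(λ₁K₁ + ⋯ + λ_sK_s)` agrees on the closed
orthant with a polynomial of total degree at most `d + n`. -/
theorem polynomial_valuation_on_minkowski_combinations {n : ℕ} (hn : 1 ≤ n) (d : ℕ)
    (φ : ConvexBody (Euc n) → ℂ) (hval : IsValuation φ) (hcont : Continuous φ)
    (hpoly : ∀ K : ConvexBody (Euc n), ∃ p : MvPolynomial (Fin n) ℂ,
      p.totalDegree ≤ d ∧ ∀ x : Euc n,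
        φ (K + ptBody x) = MvPolynomial.eval (fun i => (x i : ℂ)) p)
    (s : ℕ) (K : Fin s → ConvexBody (Euc n)) :
    ∃ p : MvPolynomial (Fin s) ℂ, p.totalDegree ≤ d + n ∧
      ∀ lam : Fin s → ℝ, (∀ i, 0 ≤ lam i) →
        φ (∑ i, lam i • K i) = MvPolynomial.eval (fun i => (lam i : ℂ)) p := by
  have hseg := fun A B => hval.exists_polynomial_add_smul (d := d) hpoly hcont A B
  obtain ⟨p, hp⟩ := exists_mvPolynomial_of_separately (D := d + n) s
    (fun lam => φ (∑ i, lam i • K i)) fun lam _ i => by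
      obtain ⟨q, hq, hqe⟩ := hseg (∑ j ∈ Finset.univ.erase i, lam j • K j) (K i)
      refine ⟨q, hq, fun t ht => ?_⟩
      rw [← hqe t ht, ← Finset.sum_erase_add _ _ (Finset.mem_univ i), Function.update_self]
      congr 2
      exact Finset.sum_congr rfl fun j hj => by
        rw [Function.update_of_ne (Finset.ne_of_mem_erase hj)]
  refine ⟨p, MvPolynomial.totalDegree_le_of_restrict p fun h => ?_, hp⟩
  obtain ⟨q, hq, hqe⟩ := hseg 0 (∑ i, (h i : ℝ) • K i)
  refine ⟨q, hq, fun t => ?_⟩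
  have h1 := hp (fun i => (t : ℝ) * h i) fun i => by positivity
  have h2 := hqe t (Nat.cast_nonneg t)
  simp only [Finset.smul_sum, smul_smul, zero_add] at h2
  rw [h2] at h1
  simpa using h1.symm
end
end
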